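/- arXiv:2407.14341 — 3 statements merged into one kernel-verified Lean document; each statement's English description precedes it below -/
import Mathlib

section
/- Let k be a number field and G a nontrivial finite abelian group. Then there exists a finite Galois extension E of k with Gal(E/k) isomorphic to G such that the absolute norm of the relative discriminant ideal of E/k (equivalently, the absolute norm of the ideal norm from O_E to O_k of the different ideal of O_E over O_k) is a sum of two squares, i.e., equals a² + b² for some integers a, b. -/
open NumberField

open Polynomial in
lemma natCast_mem_differentIdeal_of_isPrimitiveRoot (A K L B : Type*) [CommRing A] [Field K]
    [Field L] [CommRing B] [Algebra A K] [Algebra B L] [Algebra A B] [Algebra K L] [Algebra A L]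
    [IsScalarTower A K L] [IsScalarTower A B L] [IsDomain A] [IsFractionRing A K]
    [IsIntegrallyClosed A] [IsFractionRing B L] [IsDedekindDomain B] [IsIntegralClosure B A L]
    [FiniteDimensional K L] [Algebra.IsSeparable K L] [Module.IsTorsionFree A B]
    {ζ : B} {n : ℕ} (hn : n ≠ 0) (hζ : IsPrimitiveRoot ζ n)
    (h : Algebra.adjoin K {algebraMap B L ζ} = ⊤) :
    (n : B) ∈ differentIdeal A B := by
  have hint : IsIntegral A ζ := hζ.isIntegral (Nat.pos_of_ne_zero hn) |>.tower_top
  obtain ⟨g, hg⟩ : minpoly A ζ ∣ X ^ n - 1 :=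
    minpoly.isIntegrallyClosed_dvd hint (by simp [hζ.pow_eq_one])
  have hder := congrArg (fun q ↦ aeval ζ (derivative q)) hg
  simp only [derivative_mul, derivative_sub, derivative_X_pow, derivative_one, map_add, map_mul,
    minpoly.aeval, zero_mul, add_zero, sub_zero, map_pow, aeval_X, map_natCast] at hder
  have hmem : (n : B) * ζ ^ (n - 1) ∈ differentIdeal A B := by
    rw [hder]
    exact Ideal.mul_mem_right _ _ (aeval_derivative_mem_differentIdeal A K L ζ h)
  have := Ideal.mul_mem_right ζ _ hmem
  rwa [mul_assoc, pow_sub_one_mul hn, hζ.pow_eq_one, mul_one] at this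

lemma NumberField.natCast_mem_differentIdeal_of_isCyclotomicExtension (k L : Type*) [Field k]
    [NumberField k] [Field L] [NumberField L] [Algebra k L] (n : ℕ) [NeZero n]
    [IsCyclotomicExtension {n} k L] : (n : 𝓞 L) ∈ differentIdeal (𝓞 k) (𝓞 L) := by
  have hζ := IsCyclotomicExtension.zeta_spec n k L
  exact natCast_mem_differentIdeal_of_isPrimitiveRoot (𝓞 k) k L (𝓞 L) (NeZero.ne n)
    hζ.toInteger_isPrimitiveRoot (IsCyclotomicExtension.adjoin_primitive_root_eq_top hζ)

lemma NumberField.natCast_mem_differentIdeal_of_tower (k E L : Type*) [Field k]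
    [NumberField k] [Field E] [NumberField E] [Field L] [NumberField L] [Algebra k E]
    [Algebra E L] [Algebra k L] [IsScalarTower k E L] {n : ℕ}
    (h : (n : 𝓞 L) ∈ differentIdeal (𝓞 k) (𝓞 L)) : (n : 𝓞 E) ∈ differentIdeal (𝓞 k) (𝓞 E) := by
  rw [differentIdeal_eq_differentIdeal_mul_differentIdeal (𝓞 k) (𝓞 E) (𝓞 L)] at h
  have := Ideal.mul_le_right h
  rw [← map_natCast (algebraMap (𝓞 E) (𝓞 L)), ← Ideal.mem_comap,
    Ideal.comap_map_eq_self_of_faithfullyFlat] at this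
  exact this

lemma NumberField.absNorm_spanNorm_dvd_pow (k E : Type*) [Field k] [NumberField k] [Field E]
    [NumberField E] [Algebra k E] {n : ℕ} {I : Ideal (𝓞 E)} (h : (n : 𝓞 E) ∈ I) :
    Ideal.absNorm (Ideal.spanNorm (𝓞 k) I) ∣ n ^ Module.finrank ℤ (𝓞 E) := by
  rw [Ideal.spanNorm_eq, Ideal.absNorm_relNorm, ← Ideal.absNorm_span_natCast]
  exact Ideal.absNorm_dvd_absNorm_of_le ((Ideal.span_singleton_le_iff_mem _).2 h)

lemma Nat.exists_eq_sq_add_sq_of_dvd_pow {d n m : ℕ} (h : d ∣ n ^ m)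
    (hn : ∀ p, p.Prime → p ∣ n → p % 4 = 1) : ∃ a b : ℕ, d = a ^ 2 + b ^ 2 := by
  rw [Nat.eq_sq_add_sq_iff]
  intro q hq hq3
  have := hn q (Nat.prime_of_mem_primeFactors hq) ((Nat.prime_of_mem_primeFactors hq).dvd_of_dvd_pow
    ((Nat.dvd_of_mem_primeFactors hq).trans h))
  omega

open Polynomial IntermediateField in
lemma NumberField.irreducible_cyclotomic_of_coprime_discr (k : Type*) [Field k] [NumberField k]
    (n : ℕ) [NeZero n] (h : n.Coprime (discr k).natAbs) : Irreducible (cyclotomic n k) := by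
  let L := CyclotomicField n k
  have hζ := IsCyclotomicExtension.zeta_spec n k L
  set ζ := IsCyclotomicExtension.zeta n k L
  let f : k →ₐ[ℚ] L := IsScalarTower.toAlgHom ℚ k L
  let ef : k ≃ₐ[ℚ] f.fieldRange := AlgEquiv.ofInjectiveField f
  let C : IntermediateField ℚ L := adjoin ℚ {ζ}
  have : IsCyclotomicExtension {n} ℚ C := hζ.intermediateField_adjoin_isCyclotomicExtension ℚ
  have : IsGalois ℚ C := IsCyclotomicExtension.isGalois {n} ℚ C
  have hdisc : IsCoprime (discr C) (discr f.fieldRange) := by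
    rw [← discr_eq_discr_of_algEquiv k ef,
      Int.isCoprime_iff_nat_coprime, IsCyclotomicExtension.Rat.natAbs_discr n C]
    exact Nat.Coprime.coprime_div_left (h.pow_left _)
      (Nat.prod_primeFactors_pow_totient_ediv_dvd (NeZero.pos _))
  have hrank := (linearDisjoint_of_isGalois_isCoprime_discr L C f.fieldRange hdisc).finrank_sup
  have htop : C ⊔ f.fieldRange = ⊤ := by
    rw [eq_top_iff]
    intro x _
    have hx : x ∈ Algebra.adjoin k {ζ} := by
      rw [IsCyclotomicExtension.adjoin_primitive_root_eq_top hζ]; trivial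
    induction hx using Algebra.adjoin_induction with
    | mem x hx =>
      rw [Set.mem_singleton_iff.1 hx]
      exact le_sup_left (a := C) (mem_adjoin_simple_self ℚ ζ)
    | algebraMap r => exact le_sup_right (a := C) (b := f.fieldRange) ⟨r, rfl⟩
    | add x y _ _ hx hy => exact add_mem (hx trivial) (hy trivial)
    | mul x y _ _ hx hy => exact mul_mem (hx trivial) (hy trivial)
  rw [htop, finrank_top', IsCyclotomicExtension.finrank C (cyclotomic.irreducible_rat (NeZero.pos n)),
    ← ef.toLinearEquiv.finrank_eq, ← Module.finrank_mul_finrank ℚ k L,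
    mul_comm, Nat.mul_left_inj Module.finrank_pos.ne', (hζ.powerBasis k).finrank,
    IsPrimitiveRoot.powerBasis_dim] at hrank
  have hdvd : minpoly k ζ ∣ cyclotomic n k := minpoly.dvd _ _ (by
    simpa [aeval_def, eval₂_eq_eval_map, IsRoot.def] using hζ.isRoot_cyclotomic (NeZero.pos n))
  have hint : IsIntegral k ζ := .of_finite k ζ
  have := eq_of_monic_of_dvd_of_natDegree_le (minpoly.monic hint) (cyclotomic.monic n k) hdvd
    (by rw [natDegree_cyclotomic, hrank])
  rw [this]
  exact minpoly.irreducible hint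

lemma ZMod.exists_surjective_units_prime {p n : ℕ} (hp : p.Prime) (h : n ∣ p - 1) :
    ∃ f : (ZMod p)ˣ →* Multiplicative (ZMod n), Function.Surjective f := by
  have := Fact.mk hp
  have hcard : Nat.card (ZMod p)ˣ = p - 1 := by
    rw [Nat.card_eq_fintype_card, ZMod.card_units]
  let e := (zmodCyclicMulEquiv (ZMod.isCyclic_units_prime hp)).symm
  rw [← hcard] at h
  let g := AddMonoidHom.toMultiplicative (ZMod.castHom h (ZMod n)).toAddMonoidHom
  exact ⟨g.comp e.toMonoidHom, (ZMod.castHom_surjective h).comp e.surjective⟩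

lemma ZMod.exists_surjective_units_of_commGroup (G : Type*) [CommGroup G] [Finite G] (B : ℕ) :
    ∃ (n : ℕ) (f : (ZMod n)ˣ →* G), Function.Surjective f ∧ n ≠ 0 ∧
      ∀ p, p.Prime → p ∣ n → p % 4 = 1 ∧ B < p := by
  obtain ⟨ι, _, m, hm, ⟨e⟩⟩ := CommGroup.equiv_prod_multiplicative_zmod_of_finite G
  have hM : 4 * ∏ i, m i ≠ 0 :=
    mul_ne_zero four_ne_zero (Finset.prod_ne_zero_iff.2 fun i _ ↦ (hm i).ne_bot)
  have hinf := (Nat.infinite_setOfPred_prime_modEq_one hM).sdiff (Set.finite_Iic B)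
  have := hinf.to_subtype
  obtain ⟨p⟩ : Nonempty (ι ↪ ↥({p : ℕ | p.Prime ∧ p ≡ 1 [MOD 4 * ∏ i, m i]} \ Set.Iic B)) :=
    ⟨(Fintype.equivFin ι).toEmbedding.trans
      (Fin.valEmbedding.trans (Infinite.natEmbedding _))⟩
  have hp (i) : (p i : ℕ).Prime := (p i).2.1.1
  have hpmod (i) : 4 * ∏ i, m i ∣ (p i : ℕ) - 1 :=
    (Nat.modEq_iff_dvd' (hp i).one_le).1 (p i).2.1.2.symm
  have hcop : Pairwise (Function.onFun Nat.Coprime fun i ↦ (p i : ℕ)) := fun i j hij ↦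
    (Nat.coprime_primes (hp i) (hp j)).2 fun h ↦ hij (p.injective (Subtype.ext h))
  choose f hf using fun i ↦ ZMod.exists_surjective_units_prime (hp i)
    (((Finset.dvd_prod_of_mem m (Finset.mem_univ i)).mul_left 4).trans (hpmod i))
  let c := (Units.mapEquiv (ZMod.prodEquivPi _ hcop).toMulEquiv).trans MulEquiv.piUnits
  refine ⟨∏ i, (p i : ℕ), (e.symm.toMonoidHom.comp (MonoidHom.piMap f)).comp c.toMonoidHom,
    (e.symm.surjective.comp (Function.Surjective.piMap hf)).comp c.surjective,
    Finset.prod_ne_zero_iff.2 fun i _ ↦ (hp i).ne_zero, fun q hq hdvd ↦ ?_⟩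
  obtain ⟨i, -, hi⟩ := (hq.prime.dvd_finsetProd_iff _).1 hdvd
  obtain rfl := (Nat.prime_dvd_prime_iff_eq hq (hp i)).1 hi
  have h4 := (dvd_mul_right 4 _).trans (hpmod i)
  have := (hp i).two_le
  exact ⟨by omega, not_le.1 (p i).2.2⟩

/-- **Corollary 1.2 (discriminant-ideal version).** For every number field `k` and every
nontrivial finite abelian group `G` there is a finite Galois extension `E/k` with
`Gal(E/k) ≅ G` whose relative discriminant ideal (the norm from `𝓞 E` to `𝓞 k` of the
different ideal of `𝓞 E / 𝓞 k`) has absolute norm a sum of two squares. -/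
theorem exists_abelian_extension_discriminant_sum_two_squares
    (k : Type) [Field k] [NumberField k]
    (G : Type) [CommGroup G] [Finite G] [Nontrivial G] :
    ∃ (E : Type) (_ : Field E) (_ : NumberField E) (_ : Algebra k E),
      FiniteDimensional k E ∧ IsGalois k E ∧ Nonempty ((E ≃ₐ[k] E) ≃* G) ∧
      ∃ a b : ℤ,
        (Ideal.absNorm (Ideal.spanNorm (𝓞 k) (differentIdeal (𝓞 k) (𝓞 E))) : ℤ)
          = a ^ 2 + b ^ 2 := by
  obtain ⟨n, f, hf, hn, hp⟩ := ZMod.exists_surjective_units_of_commGroup G (discr k).natAbs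
  have : NeZero n := ⟨hn⟩
  have hcop : n.Coprime (discr k).natAbs := Nat.coprime_of_dvd fun p hpp hpn hpd ↦
    (hp p hpp hpn).2.not_ge (Nat.le_of_dvd (Int.natAbs_pos.2 (discr_ne_zero k)) hpd)
  let L := CyclotomicField n k
  have : IsGalois k L := IsCyclotomicExtension.isGalois {n} k L
  let e := IsCyclotomicExtension.autEquivPow L
    (NumberField.irreducible_cyclotomic_of_coprime_discr k n hcop)
  let g : Gal(L/k) →* G := f.comp e.toMonoidHom
  let E := IntermediateField.fixedField g.ker
  have hmem := natCast_mem_differentIdeal_of_tower k E L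
    (natCast_mem_differentIdeal_of_isCyclotomicExtension k L n)
  obtain ⟨a, b, hab⟩ := Nat.exists_eq_sq_add_sq_of_dvd_pow
    (absNorm_spanNorm_dvd_pow k E hmem) fun p hpp hpn ↦ (hp p hpp hpn).1
  exact ⟨E, inferInstance, inferInstance, inferInstance, inferInstance,
    .of_fixedField_normal_subgroup g.ker,
    ⟨(IsGalois.normalAutEquivQuotient g.ker).symm.trans
      (QuotientGroup.quotientKerEquivOfSurjective g (hf.comp e.surjective))⟩,
    a, b, by exact_mod_cast hab⟩
end

section
/- Let G be a nontrivial finite abelian group. Then there exists a number field E, Galois over ℚ, with Gal(E/ℚ) isomorphic to G, such that every rational prime p dividing the absolute discriminant disc(E) satisfies p ≡ 1 (mod 4); consequently |disc(E)| is a sum of two squares, i.e., |disc(E)| = a² + b² for some integers a, b. -/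
open NumberField

/-- A cyclic group surjects onto `ZMod n` for every `n` dividing its order. -/
theorem IsCyclic.exists_surjective_multiplicative_zmod {C : Type*} [Group C] (hC : IsCyclic C)
    {n : ℕ} (h : n ∣ Nat.card C) :
    ∃ f : C →* Multiplicative (ZMod n), Function.Surjective f :=
  ⟨(AddMonoidHom.toMultiplicative (ZMod.castHom h (ZMod n)).toAddMonoidHom).comp
      (zmodCyclicMulEquiv hC).symm.toMonoidHom,
    (ZMod.castHom_surjective h).comp (zmodCyclicMulEquiv hC).symm.surjective⟩

/-- Every finite abelian group is a quotient of `(ZMod N)ˣ` for some `N` all of whose prime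
factors are congruent to `1` modulo any prescribed `m ≠ 0`. -/
theorem CommGroup.exists_surjective_units_zmod (G : Type*) [CommGroup G] [Finite G] {m : ℕ}
    (hm : m ≠ 0) :
    ∃ N : ℕ, N ≠ 0 ∧ (∀ p : ℕ, p.Prime → p ∣ N → p ≡ 1 [MOD m]) ∧
      ∃ f : (ZMod N)ˣ →* G, Function.Surjective f := by
  obtain ⟨ι, _, n, hn, ⟨e⟩⟩ := CommGroup.equiv_prod_multiplicative_zmod_of_finite G
  have hM : m * ∏ i, n i ≠ 0 :=
    mul_ne_zero hm (Finset.prod_ne_zero_iff.mpr fun i _ ↦ (zero_lt_one.trans (hn i)).ne')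
  let q : ι → ℕ := fun i ↦
    (Nat.infinite_setOfPred_prime_modEq_one hM).natEmbedding _ (Fintype.equivFin ι i)
  have hq (i : ι) : (q i).Prime ∧ q i ≡ 1 [MOD m * ∏ i, n i] :=
    ((Nat.infinite_setOfPred_prime_modEq_one hM).natEmbedding _ (Fintype.equivFin ι i)).2
  have hq_inj : Function.Injective q := fun i j h ↦ by
    simpa [q, Subtype.val_inj, Fin.val_inj] using h
  have hq_coprime : Pairwise (Function.onFun Nat.Coprime q) := fun i j hij ↦
    (Nat.coprime_primes (hq i).1 (hq j).1).mpr (hq_inj.ne hij)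
  have hsurj (i : ι) :
      ∃ f : (ZMod (q i))ˣ →* Multiplicative (ZMod (n i)), Function.Surjective f := by
    have : Fact (q i).Prime := ⟨(hq i).1⟩
    refine (ZMod.isCyclic_units_prime (hq i).1).exists_surjective_multiplicative_zmod ?_
    rw [Nat.card_eq_fintype_card, ZMod.card_units]
    exact ((Finset.dvd_prod_of_mem n (Finset.mem_univ i)).mul_left m).trans
      ((Nat.modEq_iff_dvd' (hq i).1.one_le).mp (hq i).2.symm)
  choose f hf using hsurj
  let u := (Units.mapEquiv (ZMod.prodEquivPi q hq_coprime).toMulEquiv).trans MulEquiv.piUnits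
  refine ⟨∏ i, q i, Finset.prod_ne_zero_iff.mpr fun i _ ↦ (hq i).1.ne_zero, fun p hp hpN ↦ ?_,
    e.symm.toMonoidHom.comp ((MonoidHom.piMap f).comp u.toMonoidHom), ?_⟩
  · obtain ⟨i, -, hi⟩ := (hp.prime.dvd_finsetProd_iff q).mp hpN
    rw [(Nat.prime_dvd_prime_iff_eq hp (hq i).1).mp hi]
    exact (hq i).2.of_mul_right _
  · exact e.symm.surjective.comp ((Function.Surjective.piMap hf).comp u.surjective)

/-- A prime ramified in a cyclotomic field divides its conductor. -/
theorem IsCyclotomicExtension.Rat.dvd_of_prime_of_dvd_discr (n : ℕ) [NeZero n] (K : Type*)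
    [Field K] [NumberField K] [IsCyclotomicExtension {n} ℚ K] {p : ℕ} (hp : p.Prime)
    (h : (p : ℤ) ∣ NumberField.discr K) : p ∣ n := by
  rw [Int.natCast_dvd, natAbs_discr n K] at h
  exact hp.dvd_of_dvd_pow
    (h.trans (Nat.div_dvd_of_dvd (Nat.prod_primeFactors_pow_totient_ediv_dvd (NeZero.pos n))))

/-- The inverse Galois problem over `ℚ` for finite abelian groups, with all ramified primes
congruent to `1` modulo a prescribed `m ≠ 0`. -/
theorem NumberField.exists_isGalois_mulEquiv_of_commGroup (G : Type*) [CommGroup G] [Finite G]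
    {m : ℕ} (hm : m ≠ 0) :
    ∃ (E : Type) (_ : Field E) (_ : NumberField E),
      IsGalois ℚ E ∧ Nonempty ((E ≃ₐ[ℚ] E) ≃* G) ∧
      ∀ p : ℕ, p.Prime → (p : ℤ) ∣ NumberField.discr E → p ≡ 1 [MOD m] := by
  obtain ⟨N, hN, hNp, f, hf⟩ := CommGroup.exists_surjective_units_zmod G hm
  have : NeZero N := ⟨hN⟩
  let K := CyclotomicField N ℚ
  have : IsCyclotomicExtension {N} ℚ K := CyclotomicField.isCyclotomicExtension N ℚ
  have : IsGalois ℚ K := IsCyclotomicExtension.isGalois {N} ℚ K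
  let g : (K ≃ₐ[ℚ] K) →* G :=
    f.comp (IsCyclotomicExtension.Rat.galEquivZMod N K).toMonoidHom
  have hg : Function.Surjective g := hf.comp (MulEquiv.surjective _)
  refine ⟨IntermediateField.fixedField g.ker, inferInstance, inferInstance,
    IsGalois.of_fixedField_normal_subgroup g.ker,
    ⟨(IsGalois.normalAutEquivQuotient g.ker).symm.trans
      (QuotientGroup.quotientKerEquivOfSurjective g hg)⟩, fun p hp hpd ↦ hNp p hp ?_⟩
  exact IsCyclotomicExtension.Rat.dvd_of_prime_of_dvd_discr N K hp
    (hpd.trans (NumberField.discr_dvd_discr _ K))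

/-- **Corollary 1.2 for `k = ℚ`.** For every nontrivial finite abelian group `G` there is a
number field `E`, Galois over `ℚ` with `Gal(E/ℚ) ≅ G`, such that every rational prime
dividing the absolute discriminant of `E` is `≡ 1 (mod 4)`; consequently `|disc E|` is a
sum of two squares. -/
theorem exists_abelian_field_over_rat_discriminant_sum_two_squares
    (G : Type) [CommGroup G] [Finite G] [Nontrivial G] :
    ∃ (E : Type) (_ : Field E) (_ : NumberField E),
      IsGalois ℚ E ∧ Nonempty ((E ≃ₐ[ℚ] E) ≃* G) ∧
      (∀ p : ℕ, p.Prime → (p : ℤ) ∣ NumberField.discr E → p % 4 = 1) ∧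
      ∃ a b : ℤ, |NumberField.discr E| = a ^ 2 + b ^ 2 := by
  obtain ⟨E, _, _, hGal, hG, hE⟩ :=
    NumberField.exists_isGalois_mulEquiv_of_commGroup G (m := 4) (by norm_num)
  have hE' (p : ℕ) (hp : p.Prime) (hpd : (p : ℤ) ∣ NumberField.discr E) : p % 4 = 1 := hE p hp hpd
  refine ⟨E, _, _, hGal, hG, hE', ?_⟩
  obtain ⟨a, b, hab⟩ := Nat.eq_sq_add_sq_iff (n := (NumberField.discr E).natAbs) |>.mpr
    fun q hq hq3 ↦ by
      have := hE' q (Nat.prime_of_mem_primeFactors hq)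
        (Int.natCast_dvd.mpr (Nat.dvd_of_mem_primeFactors hq))
      omega
  exact ⟨a, b, by rw [Int.abs_eq_natAbs, hab]; push_cast; rfl⟩
end

section
/- For a squarefree integer d ∉ {0, 1}, let D(d) = d if d ≡ 1 (mod 4) and D(d) = 4d otherwise (so D(d) is the discriminant, equal to the conductor, of the quadratic field ℚ(√d)). Let N(B) be the number of squarefree integers d ∉ {0,1} such that |D(d)| ≤ B and |D(d)| is a sum of two squares. Then there exists a constant c > 0 such that N(B) · √(log B) / B → c as B → ∞; that is, N(B) ~ c · B · (log B)^{-1/2}. -/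
open Filter

/-- A squarefree natural number all of whose prime factors are `1` modulo `4`. -/
def IsSplitSquarefree (n : ℕ) : Prop :=
  Squarefree n ∧ ∀ p : ℕ, p.Prime → p ∣ n → p % 4 = 1

open Classical in
/-- The indicator function of the split squarefree numbers. -/
noncomputable def splitIndicator (n : ℕ) : ℝ := if IsSplitSquarefree n then 1 else 0

open Classical in
/-- The indicator function of the positive integers all of whose prime factors are `1` modulo `4`,
as a completely multiplicative function. -/
noncomputable def splitHom : ℕ →*₀ ℂ where
  toFun n := if n ≠ 0 ∧ ∀ p : ℕ, p.Prime → p ∣ n → p % 4 = 1 then 1 else 0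
  map_zero' := by simp
  map_one' := by
    rw [if_pos]
    refine ⟨one_ne_zero, fun p hp h => ?_⟩
    exact absurd (Nat.dvd_one.mp h) hp.one_lt.ne'
  map_mul' m n := by
    have key : (m * n ≠ 0 ∧ ∀ p : ℕ, p.Prime → p ∣ m * n → p % 4 = 1) ↔
        (m ≠ 0 ∧ ∀ p : ℕ, p.Prime → p ∣ m → p % 4 = 1) ∧
        (n ≠ 0 ∧ ∀ p : ℕ, p.Prime → p ∣ n → p % 4 = 1) := by
      constructor
      · rintro ⟨h0, h⟩
        exact ⟨⟨left_ne_zero_of_mul h0, fun p hp hd => h p hp (hd.mul_right n)⟩,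
          ⟨right_ne_zero_of_mul h0, fun p hp hd => h p hp (hd.mul_left m)⟩⟩
      · rintro ⟨⟨hm, h1⟩, hn, h2⟩
        exact ⟨mul_ne_zero hm hn, fun p hp hd => (hp.dvd_mul.mp hd).elim (h1 p hp) (h2 p hp)⟩
    simp only [key]
    split_ifs <;> simp_all

lemma splitHom_prime {p : ℕ} (hp : p.Prime) : splitHom p = if p % 4 = 1 then 1 else 0 := by
  simp only [splitHom, MonoidWithZeroHom.coe_mk, ZeroHom.coe_mk]
  congr 1
  apply propext
  constructor
  · exact fun h => h.2 p hp dvd_rfl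
  · exact fun h => ⟨hp.ne_zero, fun q hq hd => by rwa [(Nat.prime_dvd_prime_iff_eq hq hp).mp hd]⟩

lemma norm_splitHom_le_one (n : ℕ) : ‖splitHom n‖ ≤ 1 := by
  simp only [splitHom, MonoidWithZeroHom.coe_mk, ZeroHom.coe_mk]
  split_ifs <;> simp

lemma splitIndicator_nonneg (n : ℕ) : 0 ≤ splitIndicator n := by
  unfold splitIndicator; split_ifs <;> norm_num

lemma splitIndicator_le_one (n : ℕ) : splitIndicator n ≤ 1 := by
  unfold splitIndicator; split_ifs <;> norm_num

lemma isSplitSquarefree_one : IsSplitSquarefree 1 :=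
  ⟨squarefree_one, fun _ hp h => absurd (Nat.dvd_one.mp h) hp.one_lt.ne'⟩

lemma isSplitSquarefree_mul {m n : ℕ} (h : m.Coprime n) :
    IsSplitSquarefree (m * n) ↔ IsSplitSquarefree m ∧ IsSplitSquarefree n := by
  unfold IsSplitSquarefree
  rw [Nat.squarefree_mul h]
  constructor
  · rintro ⟨⟨a, b⟩, c⟩
    exact ⟨⟨a, fun p hp hd => c p hp (hd.mul_right n)⟩, b, fun p hp hd => c p hp (hd.mul_left m)⟩
  · rintro ⟨⟨a, c⟩, b, d⟩
    exact ⟨⟨a, b⟩, fun p hp hd => (hp.dvd_mul.mp hd).elim (c p hp) (d p hp)⟩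

lemma splitIndicator_mul {m n : ℕ} (h : m.Coprime n) :
    splitIndicator (m * n) = splitIndicator m * splitIndicator n := by
  have key := isSplitSquarefree_mul h
  unfold splitIndicator
  by_cases hm : IsSplitSquarefree m <;> by_cases hn : IsSplitSquarefree n <;>
    simp [key, hm, hn]

lemma splitIndicator_prime {p : ℕ} (hp : p.Prime) :
    splitIndicator p = if p % 4 = 1 then 1 else 0 := by
  simp only [splitIndicator]
  congr 1
  apply propext
  constructor
  · exact fun h => h.2 p hp dvd_rfl
  · exact fun h => ⟨hp.prime.squarefree,
      fun q hq hd => by rwa [(Nat.prime_dvd_prime_iff_eq hq hp).mp hd]⟩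

lemma splitIndicator_prime_pow {p : ℕ} (hp : p.Prime) {e : ℕ} (he : 2 ≤ e) :
    splitIndicator (p ^ e) = 0 := by
  rw [splitIndicator, if_neg]
  rintro ⟨h, -⟩
  have := h p (by rw [← sq]; exact pow_dvd_pow p he)
  exact hp.one_lt.ne' (Nat.isUnit_iff.mp this)

lemma summable_norm_mul_cpow {g : ℕ → ℂ} (hg : ∀ n, ‖g n‖ ≤ 1) {s : ℂ} (hs : 1 < s.re) :
    Summable fun n : ℕ => ‖g n * (n : ℂ) ^ (-s)‖ := by
  refine (summable_riemannZetaSummand hs).of_nonneg_of_le (fun _ => norm_nonneg _) fun n => ?_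
  rw [norm_mul]
  exact mul_le_of_le_one_left (norm_nonneg _) (hg n)

lemma tsum_mul_cpow_eq_LSeries (g : ℕ → ℂ) {s : ℂ} (hs : 1 < s.re) :
    ∑' n : ℕ, g n * (n : ℂ) ^ (-s) = LSeries g s := by
  have h0 : s ≠ 0 := by rintro rfl; norm_num at hs
  rw [LSeries]
  refine tsum_congr fun n => ?_
  rw [LSeries.term_of_ne_zero' h0, Complex.cpow_neg, div_eq_mul_inv]

lemma hasProd_LSeries_splitIndicator {s : ℂ} (hs : 1 < s.re) :
    HasProd (fun p : Nat.Primes => 1 + (splitIndicator p : ℂ) * (p : ℂ) ^ (-s))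
      (LSeries (fun n => (splitIndicator n : ℂ)) s) := by
  have h0 : s ≠ 0 := by rintro rfl; norm_num at hs
  have hone : splitIndicator 1 = 1 := by rw [splitIndicator, if_pos isSplitSquarefree_one]
  have key := EulerProduct.eulerProduct_hasProd
    (f := fun n : ℕ => (splitIndicator n : ℂ) * (n : ℂ) ^ (-s)) (by simp [hone])
    (by
      intro m n h
      simp only [splitIndicator_mul h, Nat.cast_mul, Complex.ofReal_mul,
        Complex.natCast_mul_natCast_cpow]
      ring)
    (summable_norm_mul_cpow (fun n => by
      rw [Complex.norm_real, Real.norm_eq_abs, abs_of_nonneg (splitIndicator_nonneg n)]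
      exact splitIndicator_le_one n) hs)
    (by simp [h0])
  rw [tsum_mul_cpow_eq_LSeries _ hs] at key
  convert key using 2 with p
  rw [tsum_eq_sum (s := Finset.range 2)]
  · simp [Finset.sum_range_succ, hone]
  · intro e he
    rw [splitIndicator_prime_pow p.2 (by rw [Finset.mem_range] at he; omega)]
    simp

/-- The completely multiplicative summand of the Dirichlet series of `splitHom`. -/
noncomputable def splitSummandHom (s : ℂ) : ℕ →*₀ ℂ where
  toFun n := splitHom n * (n : ℂ) ^ (-s)
  map_zero' := by simp
  map_one' := by simp
  map_mul' m n := by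
    simp only [map_mul, Nat.cast_mul, Complex.natCast_mul_natCast_cpow]
    ring

lemma hasProd_LSeries_splitHom {s : ℂ} (hs : 1 < s.re) :
    HasProd (fun p : Nat.Primes => (1 - splitHom p * (p : ℂ) ^ (-s))⁻¹)
      (LSeries (fun n => splitHom n) s) := by
  rw [← tsum_mul_cpow_eq_LSeries _ hs]
  exact EulerProduct.eulerProduct_completely_multiplicative_hasProd (f := splitSummandHom s)
    (summable_norm_mul_cpow norm_splitHom_le_one hs)

lemma LSeries_splitHom_ne_zero {s : ℂ} (hs : 1 < s.re) :
    LSeries (fun n => splitHom n) s ≠ 0 := by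
  rw [← tsum_mul_cpow_eq_LSeries _ hs]
  have := EulerProduct.exp_tsum_primes_log_eq_tsum (f := splitSummandHom s)
    (summable_norm_mul_cpow norm_splitHom_le_one hs)
  change Complex.exp _ = ∑' n : ℕ, splitHom n * (n : ℂ) ^ (-s) at this
  rw [← this]
  exact Complex.exp_ne_zero _

/-- The nontrivial Dirichlet character modulo `4` with complex values. -/
noncomputable def chiFour : DirichletCharacter ℂ 4 := ZMod.χ₄.ringHomComp (Int.castRingHom ℂ)

lemma chiFour_ne_one : chiFour ≠ 1 := by
  intro h
  have h1 : chiFour (3 : ZMod 4) = -1 := by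
    rw [chiFour, MulChar.ringHomComp_apply, show ZMod.χ₄ 3 = -1 from rfl]; simp
  rw [h, MulChar.one_apply (by decide)] at h1
  norm_num at h1

lemma LSeries_splitIndicator_sq_mul {s : ℂ} (hs : 1 < s.re) :
    LSeries (fun n => (splitIndicator n : ℂ)) s ^ 2 *
      (LSeries (fun n => (1 : DirichletCharacter ℂ 4) n) (2 * s) *
        LSeries (fun n => splitHom n) (2 * s)) =
    LSeries (fun n => (1 : DirichletCharacter ℂ 4) n) s * LSeries (fun n => chiFour n) s := by
  have hs2 : 1 < (2 * s).re := by simp; linarith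
  have hF := hasProd_LSeries_splitIndicator hs
  have hE := hasProd_LSeries_splitHom hs2
  have h1 := DirichletCharacter.LSeries_eulerProduct_hasProd (1 : DirichletCharacter ℂ 4) hs
  have h1' := DirichletCharacter.LSeries_eulerProduct_hasProd (1 : DirichletCharacter ℂ 4) hs2
  have h4 := DirichletCharacter.LSeries_eulerProduct_hasProd chiFour hs
  rw [sq]
  refine ((hF.mul hF).mul (h1'.mul hE)).unique ?_
  convert h1.mul h4 using 2 with p
  have hp := p.2
  have hx : ‖((p : ℕ) : ℂ) ^ (-s)‖ < 1 := by
    rw [Complex.norm_natCast_cpow_of_pos hp.pos]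
    exact Real.rpow_lt_one_of_one_lt_of_neg (by exact_mod_cast hp.one_lt) (by simp; linarith)
  have h2 : ((p : ℕ) : ℂ) ^ (-(2 * s)) = (((p : ℕ) : ℂ) ^ (-s)) ^ 2 := by
    rw [← Complex.cpow_nat_mul]; congr 1; push_cast; ring
  rw [splitIndicator_prime hp, splitHom_prime hp, h2]
  set x := ((p : ℕ) : ℂ) ^ (-s)
  have hx1 : 1 - x ≠ 0 := by
    intro h
    rw [← sub_eq_zero.mp h] at hx; simp at hx
  have hx2 : 1 + x ≠ 0 := by
    intro h
    rw [← neg_eq_of_add_eq_zero_right h] at hx; simp at hx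
  have hx3 : 1 - x ^ 2 ≠ 0 := by
    rw [show 1 - x ^ 2 = (1 - x) * (1 + x) by ring]; exact mul_ne_zero hx1 hx2
  have hchi : chiFour ((p : ℕ) : ZMod 4) = ((ZMod.χ₄ ((p : ℕ) : ZMod 4) : ℤ) : ℂ) := by
    rw [chiFour, MulChar.ringHomComp_apply]; rfl
  rcases hp.eq_two_or_odd' with h | h
  · have e1 : (1 : DirichletCharacter ℂ 4) ((p : ℕ) : ZMod 4) = 0 := by
      apply MulChar.map_nonunit
      rw [h]; decide
    rw [hchi, e1, h]
    have : ZMod.χ₄ ((2 : ℕ) : ZMod 4) = 0 := by rfl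
    rw [this]; norm_num
  · have e1 : (1 : DirichletCharacter ℂ 4) ((p : ℕ) : ZMod 4) = 1 := by
      apply MulChar.one_apply
      rw [ZMod.isUnit_iff_coprime]
      exact (Nat.Coprime.pow_right 2 (Nat.coprime_two_right.mpr h))
    rw [hchi, e1]
    have h4 : (p : ℕ) % 4 = 1 ∨ (p : ℕ) % 4 = 3 := by
      rcases h with ⟨k, hk⟩; omega
    rcases h4 with h4 | h4
    · rw [ZMod.χ₄_nat_one_mod_four h4, if_pos h4, if_pos h4]
      push_cast
      field_simp
      ring
    · rw [ZMod.χ₄_nat_three_mod_four h4, if_neg (by omega), if_neg (by omega)]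
      push_cast
      simp only [zero_mul, sub_zero, add_zero, one_mul, mul_one, inv_one, neg_mul, sub_neg_eq_add]
      rw [← mul_inv, show (1 - x) * (1 + x) = 1 - x ^ 2 by ring]

lemma differentiableOn_LSeries_splitHom :
    DifferentiableOn ℂ (LSeries (fun n => splitHom n)) {s | 1 < s.re} := by
  refine (LSeries_differentiableOn _).mono fun s hs => ?_
  refine lt_of_le_of_lt (LSeries.abscissaOfAbsConv_le_of_le_const ?_)
    (by exact_mod_cast (show 1 < s.re from hs))
  exact ⟨1, fun n _ => norm_splitHom_le_one n⟩

lemma exists_LSeries_splitIndicator_sq :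
    ∃ Z : ℂ → ℂ, DifferentiableOn ℂ Z {s | 1 / 2 < s.re} ∧ (∀ s, 1 ≤ s.re → Z s ≠ 0) ∧
      ∀ s, 1 < s.re → LSeries (fun n => (splitIndicator n : ℂ)) s ^ 2 * (s - 1) = Z s := by
  have hne : ∀ s : ℂ, 1 / 2 < s.re →
      DirichletCharacter.LFunction (1 : DirichletCharacter ℂ 4) (2 * s) *
        LSeries (fun n => splitHom n) (2 * s) ≠ 0 := by
    intro s hs
    have hs2 : 1 < (2 * s).re := by simp; linarith
    refine mul_ne_zero ?_ (LSeries_splitHom_ne_zero hs2)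
    exact DirichletCharacter.LFunction_ne_zero_of_one_le_re _
      (Or.inr (by rintro h; rw [h] at hs2; simp at hs2)) hs2.le
  refine ⟨fun s => DirichletCharacter.LFunctionTrivChar₁ 4 s *
    DirichletCharacter.LFunction chiFour s /
      (DirichletCharacter.LFunction (1 : DirichletCharacter ℂ 4) (2 * s) *
        LSeries (fun n => splitHom n) (2 * s)), ?_, ?_, ?_⟩
  · refine DifferentiableOn.div ?_ ?_ hne
    · exact ((DirichletCharacter.differentiable_LFunctionTrivChar₁ 4).mul
        (DirichletCharacter.differentiable_LFunction chiFour_ne_one)).differentiableOn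
    · intro s hs
      have hs2 : 1 < (2 * s).re := by
        have : 1 / 2 < s.re := hs
        simp; linarith
      refine DifferentiableAt.differentiableWithinAt (DifferentiableAt.mul ?_ ?_)
      · refine DifferentiableAt.comp s (f := fun s => 2 * s)
          (DirichletCharacter.differentiableAt_LFunction _ _ (Or.inl ?_)) (by fun_prop)
        rintro h; rw [h] at hs2; simp at hs2
      · refine DifferentiableAt.comp s (f := fun s => 2 * s)
          ((differentiableOn_LSeries_splitHom _ hs2).differentiableAt ?_) (by fun_prop)
        exact (isOpen_lt continuous_const Complex.continuous_re).mem_nhds hs2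
  · intro s hs
    refine div_ne_zero (mul_ne_zero ?_ ?_) (hne s (by linarith))
    · by_cases h : s = 1
      · rw [h]; exact DirichletCharacter.LFunctionTrivChar₁_apply_one_ne_zero 4
      · rw [DirichletCharacter.LFunctionTrivChar₁, Function.update_of_ne h]
        exact mul_ne_zero (sub_ne_zero.mpr h)
          (DirichletCharacter.LFunction_ne_zero_of_one_le_re _ (Or.inr h) hs)
    · exact DirichletCharacter.LFunction_ne_zero_of_one_le_re _ (Or.inl chiFour_ne_one) hs
  · intro s hs
    have h : s ≠ 1 := by rintro rfl; simp at hs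
    have hs2 : 1 < (2 * s).re := by simp; linarith
    rw [eq_div_iff (hne s (by linarith)), DirichletCharacter.LFunctionTrivChar₁,
      Function.update_of_ne h, DirichletCharacter.LFunction_eq_LSeries _ hs2,
      DirichletCharacter.LFunctionTrivChar,
      DirichletCharacter.LFunction_eq_LSeries _ hs, DirichletCharacter.LFunction_eq_LSeries _ hs]
    linear_combination (s - 1) * LSeries_splitIndicator_sq_mul hs

/-- If `Φ² z` extends to a nonvanishing holomorphic function across the imaginary axis, then
`-Φ'` is a multiple of `z ^ (-3/2)` up to an error `O(|z| ^ (-1/2))`, locally uniformly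
in `im z`. -/
theorem exists_norm_neg_deriv_sub_le {Φ Y : ℂ → ℂ}
    (hΦ : DifferentiableOn ℂ Φ {z | 0 < z.re})
    (hY : DifferentiableOn ℂ Y {z | -(1 / 2) < z.re})
    (hY0 : ∀ z, 0 ≤ z.re → Y z ≠ 0)
    (hsq : ∀ z, 0 < z.re → Φ z ^ 2 * z = Y z)
    (hpos : ∀ x : ℝ, 0 < x → ∃ r : ℝ, 0 ≤ r ∧ Φ x = r) :
    ∃ c : ℝ, 0 < c ∧ ∀ T : ℝ, ∃ M : ℝ, ∀ z : ℂ, 0 < z.re → z.re ≤ 1 → |z.im| ≤ T →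
      ‖-deriv Φ z - c * z ^ (-(3 / 2) : ℂ)‖ ≤ M * ‖z‖ ^ (-(1 / 2) : ℝ) := by
  have hopen : IsOpen {z : ℂ | 0 < z.re} := isOpen_lt continuous_const Complex.continuous_re
  have hopenY : IsOpen {z : ℂ | -(1 / 2) < z.re} := isOpen_lt continuous_const Complex.continuous_re
  set V : ℂ → ℂ := fun z => Φ z * z ^ (1 / 2 : ℂ) with hV
  have hne : ∀ z : ℂ, 0 < z.re → z ≠ 0 := by rintro z hz rfl; simp at hz
  have hslit : ∀ z : ℂ, 0 < z.re → z ∈ Complex.slitPlane := fun z hz => Or.inl hz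
  have hVsq : ∀ z, 0 < z.re → V z ^ 2 = Y z := by
    intro z hz
    rw [← hsq z hz, hV]
    simp only [mul_pow]
    congr 1
    rw [← Complex.cpow_nat_mul]; norm_num
  have hVd : ∀ z, 0 < z.re → DifferentiableAt ℂ V z := by
    intro z hz
    refine (hΦ.differentiableAt (hopen.mem_nhds hz)).mul ?_
    exact (differentiableAt_id.cpow_const (hslit z hz))
  have hYd : ∀ z, 0 ≤ z.re → DifferentiableAt ℂ Y z := fun z hz =>
    hY.differentiableAt (hopenY.mem_nhds (by simp only [Set.mem_ofPred_eq]; linarith))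
  have hderiv : ∀ z, 0 < z.re → 2 * V z * deriv V z = deriv Y z := by
    intro z hz
    have h1 : deriv (fun z => V z ^ 2) z = deriv Y z := by
      apply EventuallyEq.deriv_eq
      filter_upwards [hopen.mem_nhds hz] with w hw using hVsq w hw
    rw [← h1, ((hVd z hz).hasDerivAt.fun_pow 2).deriv]
    ring
  have hVnorm : ∀ z, 0 < z.re → ‖V z‖ ^ 2 = ‖Y z‖ := by
    intro z hz; rw [← hVsq z hz, norm_pow]
  have hV1 : Tendsto (fun x : ℝ => V x) (nhdsWithin 0 (Set.Ioi 0))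
      (nhds ((Real.sqrt ‖Y 0‖ : ℝ) : ℂ)) := by
    have h1 : Tendsto (fun x : ℝ => ((Real.sqrt ‖Y x‖ : ℝ) : ℂ)) (nhdsWithin 0 (Set.Ioi 0))
        (nhds ((Real.sqrt ‖Y 0‖ : ℝ) : ℂ)) := by
      have h2 : ContinuousAt (fun x : ℝ => ((Real.sqrt ‖Y x‖ : ℝ) : ℂ)) 0 := by
        have h3 : ContinuousAt (fun x : ℝ => Y x) 0 :=
          ContinuousAt.comp (f := fun x : ℝ => (x : ℂ)) (by
            simpa using (hYd 0 le_rfl).continuousAt) Complex.continuous_ofReal.continuousAt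
        exact Complex.continuous_ofReal.continuousAt.comp
          (Real.continuous_sqrt.continuousAt.comp h3.norm)
      have h4 := h2.tendsto.mono_left (nhdsWithin_le_nhds (s := Set.Ioi 0))
      simpa using h4
    refine h1.congr' ?_
    filter_upwards [self_mem_nhdsWithin] with x hx
    have hx : 0 < x := hx
    obtain ⟨r, hr, hΦr⟩ := hpos x hx
    have e1 : V x = ((r * Real.sqrt x : ℝ) : ℂ) := by
      simp only [hV, hΦr]
      push_cast
      congr 1
      rw [Real.sqrt_eq_rpow, Complex.ofReal_cpow hx.le]
      norm_num
    have e2 := hVnorm x (by simpa using hx)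
    rw [e1, Complex.norm_real, Real.norm_eq_abs, sq_abs] at e2
    rw [e1, ← e2, Real.sqrt_sq (by positivity)]
  refine ⟨Real.sqrt ‖Y 0‖ / 2, ?_, fun T => ?_⟩
  · have := hY0 0 le_rfl
    positivity
  set K : Set ℂ := {z | 0 ≤ z.re ∧ z.re ≤ 1 ∧ |z.im| ≤ max T 0} with hK
  have hKc : IsCompact K := by
    have : K = Set.Icc 0 1 ×ℂ Set.Icc (-max T 0) (max T 0) := by
      ext z; simp only [hK, Complex.mem_reProdIm, abs_le, Set.mem_ofPred_eq, Set.mem_Icc, and_assoc]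
    rw [this]
    exact isCompact_Icc.reProdIm isCompact_Icc
  have hKne : K.Nonempty := ⟨0, by simp [hK]⟩
  obtain ⟨z0, hz0, hmin⟩ := hKc.exists_isMinOn hKne
    (f := fun z => ‖Y z‖) (fun z hz => (hYd z hz.1).continuousAt.norm.continuousWithinAt)
  have hm0 : 0 < ‖Y z0‖ := norm_pos_iff.mpr (hY0 z0 hz0.1)
  obtain ⟨D, hD⟩ := hKc.exists_bound_of_continuousOn (f := deriv Y)
    (fun z hz => ((hY.deriv hopenY).differentiableAt (hopenY.mem_nhds (by
      have := hz.1
      simp only [Set.mem_ofPred_eq]; linarith))).continuousAt.continuousWithinAt)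
  have hD0 : 0 ≤ D := (norm_nonneg _).trans (hD z0 hz0)
  set L : ℝ := D / (2 * Real.sqrt ‖Y z0‖) with hL
  have hL0 : 0 ≤ L := by positivity
  set K' : Set ℂ := {z | 0 < z.re ∧ z.re ≤ 1 ∧ |z.im| ≤ max T 0} with hK'
  have hVL : ∀ z ∈ K', ‖deriv V z‖ ≤ L := by
    intro z hz
    have hzK : z ∈ K := ⟨hz.1.le, hz.2⟩
    have h1 := hD z hzK
    rw [← hderiv z hz.1, norm_mul, norm_mul] at h1
    have h2 : Real.sqrt ‖Y z0‖ ≤ ‖V z‖ := by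
      apply Real.sqrt_le_iff.mpr
      exact ⟨norm_nonneg _, by rw [hVnorm z hz.1]; exact hmin hzK⟩
    rw [hL, le_div_iff₀ (by positivity)]
    refine le_trans ?_ h1
    simp only [Complex.norm_ofNat]
    nlinarith [norm_nonneg (deriv V z)]
  have hconv : Convex ℝ K' := by
    have : K' = Complex.re ⁻¹' Set.Ioc 0 1 ∩ Complex.im ⁻¹' Set.Icc (-max T 0) (max T 0) := by
      ext z; simp only [hK', abs_le, Set.mem_ofPred_eq, Set.mem_Icc, Set.mem_Ioc, Set.mem_inter_iff,
        Set.mem_preimage, and_assoc]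
    rw [this]
    exact ((convex_Ioc 0 1).linear_preimage Complex.reLm).inter
      ((convex_Icc _ _).linear_preimage Complex.imLm)
  have hlip : ∀ z ∈ K', ‖V z - (Real.sqrt ‖Y 0‖ : ℝ)‖ ≤ L * ‖z‖ := by
    intro z hz
    have h1 : Tendsto (fun x : ℝ => ‖V z - V x‖) (nhdsWithin 0 (Set.Ioi 0))
        (nhds ‖V z - (Real.sqrt ‖Y 0‖ : ℝ)‖) := (tendsto_const_nhds.sub hV1).norm
    have h2 : Tendsto (fun x : ℝ => L * ‖z - x‖) (nhdsWithin 0 (Set.Ioi 0))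
        (nhds (L * ‖z‖)) := by
      have : Continuous fun x : ℝ => L * ‖z - x‖ := by fun_prop
      have := (this.tendsto 0).mono_left (nhdsWithin_le_nhds (s := Set.Ioi 0))
      simpa using this
    refine le_of_tendsto_of_tendsto h1 h2 ?_
    filter_upwards [Ioo_mem_nhdsGT (show (0 : ℝ) < 1 by norm_num)] with x hx
    exact hconv.norm_image_sub_le_of_norm_deriv_le (fun w hw => hVd w hw.1) hVL
      ⟨by simpa using hx.1, by simpa using hx.2.le, by simp⟩ hz
  refine ⟨L + L / 2, fun z hz hz1 hzT => ?_⟩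
  have hzK : z ∈ K' := ⟨hz, hz1, hzT.trans (le_max_left _ _)⟩
  have hz0 := hne z hz
  have hdΦ : deriv Φ z = deriv V z * z ^ (-(1 / 2) : ℂ) +
      V z * (-(1 / 2) * z ^ (-(3 / 2) : ℂ)) := by
    have e1 : Φ =ᶠ[nhds z] fun w => V w * w ^ (-(1 / 2) : ℂ) := by
      filter_upwards [hopen.mem_nhds hz] with w hw
      simp only [hV]
      rw [mul_assoc, ← Complex.cpow_add _ _ (hne w hw)]
      norm_num
    rw [e1.deriv_eq]
    have h2 : HasDerivAt (fun w : ℂ => w ^ (-(1 / 2) : ℂ))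
        (-(1 / 2) * z ^ (-(3 / 2) : ℂ)) z := by
      have := (hasDerivAt_id z).cpow_const (c := -(1 / 2)) (hslit z hz)
      convert this using 1
      simp only [id]
      norm_num
    exact ((hVd z hz).hasDerivAt.mul h2).deriv
  have hn1 : ‖z ^ (-(1 / 2) : ℂ)‖ = ‖z‖ ^ (-(1 / 2) : ℝ) := by
    rw [← Complex.norm_cpow_real]; norm_num
  have hn3 : ‖z‖ * ‖z ^ (-(3 / 2) : ℂ)‖ = ‖z‖ ^ (-(1 / 2) : ℝ) := by
    rw [show (-(3 / 2) : ℂ) = ((-(3 / 2) : ℝ) : ℂ) by norm_num, Complex.norm_cpow_real]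
    nth_rewrite 1 [← Real.rpow_one ‖z‖]
    rw [← Real.rpow_add (norm_pos_iff.mpr hz0)]
    norm_num
  have e : -deriv Φ z - ((Real.sqrt ‖Y 0‖ / 2 : ℝ) : ℂ) * z ^ (-(3 / 2) : ℂ) =
      -(deriv V z * z ^ (-(1 / 2) : ℂ)) +
        1 / 2 * ((V z - (Real.sqrt ‖Y 0‖ : ℝ)) * z ^ (-(3 / 2) : ℂ)) := by
    rw [hdΦ]; push_cast; ring
  rw [e]
  refine (norm_add_le _ _).trans ?_
  rw [norm_neg, norm_mul, norm_mul, norm_mul, hn1]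
  have h1 := mul_le_mul_of_nonneg_right (hVL z hzK)
    (Real.rpow_nonneg (norm_nonneg z) (-(1 / 2)))
  have h2 := mul_le_mul_of_nonneg_right (hlip z hzK) (norm_nonneg (z ^ (-(3 / 2) : ℂ)))
  rw [mul_assoc, hn3] at h2
  norm_num at h1 h2 ⊢
  linarith

/-- The Fejér kernel, as the cosine transform of the triangle function. -/
noncomputable def fejer (v : ℝ) : ℝ := 2 * ∫ t in (0 : ℝ)..1, (1 - t) * Real.cos (t * v)

lemma continuous_fejer : Continuous fejer := by
  unfold fejer
  refine continuous_const.mul ?_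
  exact intervalIntegral.continuous_parametric_intervalIntegral_of_continuous'
    (f := fun v t => (1 - t) * Real.cos (t * v)) (by fun_prop) 0 1

lemma fejer_mul_sq (v : ℝ) : fejer v * v ^ 2 = 2 * (1 - Real.cos v) := by
  rcases eq_or_ne v 0 with rfl | hv
  · simp
  have h := intervalIntegral.integral_eq_sub_of_hasDerivAt (a := 0) (b := 1)
    (f := fun t => (1 - t) * Real.sin (t * v) / v - Real.cos (t * v) / v ^ 2)
    (f' := fun t => (1 - t) * Real.cos (t * v)) (fun t _ => by
      have h1 : HasDerivAt (fun t : ℝ => t * v) v t := by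
        simpa using (hasDerivAt_id t).mul_const v
      have h2 := ((((hasDerivAt_id t).const_sub 1).mul h1.sin).div_const v).sub
        (h1.cos.div_const (v ^ 2))
      refine h2.congr_deriv ?_
      simp only [id]
      field_simp
      ring)
    (Continuous.intervalIntegrable (by fun_prop) _ _)
  rw [fejer, h]
  simp
  field_simp
  ring

lemma fejer_zero : fejer 0 = 1 := by
  have h := intervalIntegral.integral_eq_sub_of_hasDerivAt (a := 0) (b := 1)
    (f := fun t : ℝ => t - t ^ 2 / 2) (f' := fun t => 1 - t) (fun t _ => by
      have h2 := (hasDerivAt_id t).sub (((hasDerivAt_id t).pow 2).div_const 2)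
      refine h2.congr_deriv ?_
      simp)
    (Continuous.intervalIntegrable (by fun_prop) _ _)
  simp only [fejer, mul_zero, Real.cos_zero, mul_one]
  rw [h]
  norm_num

lemma fejer_nonneg (v : ℝ) : 0 ≤ fejer v := by
  rcases eq_or_ne v 0 with rfl | hv
  · rw [fejer_zero]; exact zero_le_one
  have h := fejer_mul_sq v
  have h1 := Real.cos_le_one v
  have h2 : 0 < v ^ 2 := by positivity
  by_contra! h3
  nlinarith

lemma fejer_le_one (v : ℝ) : fejer v ≤ 1 := by
  rw [← fejer_zero, fejer, fejer]
  refine mul_le_mul_of_nonneg_left ?_ zero_le_two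
  refine intervalIntegral.integral_mono_on zero_le_one
    (Continuous.intervalIntegrable (by fun_prop) _ _)
    (Continuous.intervalIntegrable (by fun_prop) _ _) fun t ht => ?_
  rw [mul_zero, Real.cos_zero]
  exact mul_le_mul_of_nonneg_left (Real.cos_le_one _) (by linarith [ht.2])

lemma integrable_one_add_sqrt_mul_fejer :
    MeasureTheory.Integrable fun v : ℝ => (1 + Real.sqrt |v|) * fejer v := by
  have h := integrable_one_add_norm (E := ℝ) (μ := MeasureTheory.volume) (r := 3 / 2)
    (by simp; norm_num)
  refine (h.const_mul 20).mono' (by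
    have := continuous_fejer
    exact Continuous.aestronglyMeasurable (by fun_prop)) (Eventually.of_forall fun v => ?_)
  rw [Real.norm_eq_abs, abs_of_nonneg (mul_nonneg (by positivity) (fejer_nonneg v)),
    Real.norm_eq_abs]
  set y := Real.sqrt (1 + |v|) with hy
  have hv0 := abs_nonneg v
  have hy2 : y ^ 2 = 1 + |v| := Real.sq_sqrt (by positivity)
  have hy1 : 1 ≤ y := by rw [hy]; exact Real.one_le_sqrt.mpr (by linarith)
  have h1 : Real.sqrt |v| ≤ y := Real.sqrt_le_sqrt (by linarith)
  have h2 : (1 + |v|) ^ (-(3 / 2) : ℝ) = 1 / y ^ 3 := by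
    rw [hy, Real.sqrt_eq_rpow, ← Real.rpow_natCast, ← Real.rpow_mul (by positivity),
      Real.rpow_neg (by positivity)]
    norm_num
  rw [h2, ← mul_div_assoc, le_div_iff₀ (by positivity)]
  have h3 : fejer v * (1 + v ^ 2) ≤ 5 := by
    have := fejer_mul_sq v
    have := fejer_le_one v
    have := Real.neg_one_le_cos v
    linarith
  have h4 : y ^ 4 ≤ 2 * (1 + v ^ 2) := by
    have : y ^ 4 = (1 + |v|) ^ 2 := by rw [← hy2]; ring
    rw [this, ← sq_abs v]
    nlinarith [sq_nonneg (1 - |v|)]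
  have hf := fejer_nonneg v
  calc (1 + Real.sqrt |v|) * fejer v * y ^ 3 ≤ (y + y) * fejer v * y ^ 3 := by gcongr
    _ = 2 * (fejer v * y ^ 4) := by ring
    _ ≤ 2 * (fejer v * (2 * (1 + v ^ 2))) := by gcongr
    _ ≤ 20 * 1 := by linarith

lemma integrable_fejer : MeasureTheory.Integrable fejer := by
  refine integrable_one_add_sqrt_mul_fejer.mono' continuous_fejer.aestronglyMeasurable
    (Eventually.of_forall fun v => ?_)
  rw [Real.norm_eq_abs, abs_of_nonneg (fejer_nonneg v)]
  exact le_mul_of_one_le_left (fejer_nonneg v) (by linarith [Real.sqrt_nonneg |v|])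

lemma integral_fejer_pos : 0 < ∫ v, fejer v :=
  MeasureTheory.integral_pos_of_integrable_nonneg_nonzero (x := 0) continuous_fejer
    integrable_fejer fejer_nonneg (by rw [fejer_zero]; exact one_ne_zero)

open MeasureTheory in
/-- Smoothing against a dilated Fejér kernel is bounded as soon as the Laplace transform is
`O(|z| ^ (-1/2))` locally uniformly in `im z`. -/
lemma exists_abs_integral_mul_fejer_le {d : ℝ → ℝ}
    (hd : ∀ δ : ℝ, 0 < δ → Integrable fun u => d u * Real.exp (-(δ * u)))
    (hL : ∀ T : ℝ, ∃ M : ℝ, ∀ z : ℂ, 0 < z.re → z.re ≤ 1 → |z.im| ≤ T →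
      ‖∫ u : ℝ, (d u : ℂ) * Complex.exp (-(z * u))‖ ≤ M * ‖z‖ ^ (-(1 / 2) : ℝ))
    {l : ℝ} (hl : 0 < l) :
    ∃ M : ℝ, ∀ δ : ℝ, 0 < δ → δ ≤ 1 → ∀ x : ℝ,
      |∫ u, d u * Real.exp (-(δ * u)) * (l * fejer (l * (x - u)))| ≤ M := by
  obtain ⟨M, hM⟩ := hL l
  refine ⟨∫ t in (0 : ℝ)..1, 2 * l * (|M| * (l * t) ^ (-(1 / 2) : ℝ)), fun δ hδ hδ1 x => ?_⟩
  have e1 : ∀ u, d u * Real.exp (-(δ * u)) * (l * fejer (l * (x - u))) =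
      ∫ t in (0 : ℝ)..1, d u * Real.exp (-(δ * u)) *
        (2 * l * (1 - t) * Real.cos (t * (l * (x - u)))) := by
    intro u
    rw [fejer, intervalIntegral.integral_const_mul]
    congr 1
    rw [← mul_assoc, ← intervalIntegral.integral_const_mul]
    refine intervalIntegral.integral_congr fun t _ => ?_
    ring
  simp_rw [e1]
  have hint : Integrable (Function.uncurry fun (u t : ℝ) => d u * Real.exp (-(δ * u)) *
      (2 * l * (1 - t) * Real.cos (t * (l * (x - u)))))
      (volume.prod (volume.restrict (Set.Ioc (0 : ℝ) 1))) := by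
    have h1 : Integrable (fun p : ℝ × ℝ => d p.1 * Real.exp (-(δ * p.1)) * (2 * l * (1 - p.2)))
        (volume.prod (volume.restrict (Set.Ioc (0 : ℝ) 1))) :=
      (hd δ hδ).mul_prod (f := fun u => d u * Real.exp (-(δ * u))) (g := fun t => 2 * l * (1 - t))
        (Continuous.integrableOn_Ioc (by fun_prop))
    have h2 := h1.mul_bdd (c := 1) (g := fun p : ℝ × ℝ => Real.cos (p.2 * (l * (x - p.1))))
      (Continuous.aestronglyMeasurable (by fun_prop))
      (Eventually.of_forall fun p => by rw [Real.norm_eq_abs]; exact Real.abs_cos_le_one _)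
    refine h2.congr (Eventually.of_forall fun p => ?_)
    simp only [Function.uncurry]
    ring
  rw [integral_congr_ae (Eventually.of_forall fun u =>
    intervalIntegral.integral_of_le (μ := volume) zero_le_one), integral_integral_swap hint,
    ← intervalIntegral.integral_of_le zero_le_one, ← Real.norm_eq_abs]
  have hrpow : IntervalIntegrable (fun t : ℝ => 2 * l * (|M| * (l * t) ^ (-(1 / 2) : ℝ)))
      volume 0 1 := by
    have h := ((intervalIntegral.intervalIntegrable_rpow' (a := 0) (b := 1)
      (show (-1 : ℝ) < -(1 / 2) by norm_num)).const_mul (2 * l * (|M| * l ^ (-(1 / 2) : ℝ))))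
    refine h.congr fun t ht => ?_
    rw [Set.uIoc_of_le zero_le_one] at ht
    rw [Real.mul_rpow hl.le ht.1.le]
    ring
  refine intervalIntegral.norm_integral_le_of_norm_le zero_le_one
    (Eventually.of_forall fun t ht => ?_) hrpow
  set z : ℂ := ⟨δ, l * t⟩ with hz
  have hlt : 0 < l * t := mul_pos hl ht.1
  have hzint : Integrable fun u : ℝ => (d u : ℂ) * Complex.exp (-(z * u)) := by
    have h1 := (hd δ hδ).ofReal (𝕜 := ℂ)
    have h2 := h1.mul_bdd (c := 1) (g := fun u : ℝ => Complex.exp (-(l * t * u : ℝ) * Complex.I))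
      (Continuous.aestronglyMeasurable (by fun_prop))
      (Eventually.of_forall fun u => by
        rw [← Complex.ofReal_neg, Complex.norm_exp_ofReal_mul_I])
    refine h2.congr (Eventually.of_forall fun u => ?_)
    simp only [Complex.coe_algebraMap]
    push_cast
    rw [mul_assoc, ← Complex.exp_add]
    congr 2
    apply Complex.ext <;> simp [hz]
  have e2 : ∫ u, d u * Real.exp (-(δ * u)) * (2 * l * (1 - t) * Real.cos (t * (l * (x - u)))) =
      2 * l * (1 - t) * (Complex.exp ((l * t * x : ℝ) * Complex.I) *
        ∫ u : ℝ, (d u : ℂ) * Complex.exp (-(z * u))).re := by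
    rw [← integral_const_mul]
    change _ = _ * Complex.reCLM _
    rw [← ContinuousLinearMap.integral_comp_comm _ (hzint.const_mul _), ← integral_const_mul]
    refine integral_congr_ae (Eventually.of_forall fun u => ?_)
    have e3 : Complex.exp ((l * t * x : ℝ) * Complex.I) * ((d u : ℂ) * Complex.exp (-(z * u))) =
        ((d u * Real.exp (-(δ * u)) : ℝ) : ℂ) *
          Complex.exp ((t * (l * (x - u)) : ℝ) * Complex.I) := by
      push_cast
      rw [mul_left_comm, ← Complex.exp_add, mul_assoc _ (Complex.exp _), ← Complex.exp_add]
      congr 2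
      apply Complex.ext <;> simp [hz]
      ring
    simp only [Complex.reCLM_apply]
    rw [e3, Complex.re_ofReal_mul, Complex.exp_ofReal_mul_I_re]
    ring
  rw [e2, norm_mul, Real.norm_eq_abs, Real.norm_eq_abs,
    abs_of_nonneg (mul_nonneg (by positivity) (by linarith [ht.2]))]
  have h1 := Complex.abs_re_le_norm (Complex.exp ((l * t * x : ℝ) * Complex.I) *
        ∫ u : ℝ, (d u : ℂ) * Complex.exp (-(z * u)))
  rw [norm_mul, Complex.norm_exp_ofReal_mul_I, one_mul] at h1
  have h2 := hM z hδ hδ1 (by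
    simp only [hz]
    rw [abs_of_pos hlt]
    nlinarith [ht.2])
  have h3 : ‖z‖ ^ (-(1 / 2) : ℝ) ≤ (l * t) ^ (-(1 / 2) : ℝ) := by
    apply Real.rpow_le_rpow_of_nonpos hlt _ (by norm_num)
    have := Complex.abs_im_le_norm z
    simp only [hz] at this ⊢
    rwa [abs_of_pos hlt] at this
  have h4 : M * ‖z‖ ^ (-(1 / 2) : ℝ) ≤ |M| * (l * t) ^ (-(1 / 2) : ℝ) :=
    mul_le_mul (le_abs_self M) h3 (Real.rpow_nonneg (norm_nonneg _) _) (abs_nonneg _)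
  refine mul_le_mul ?_ (h1.trans (h2.trans h4)) (abs_nonneg _) (by positivity)
  nlinarith [ht.1]

open MeasureTheory in
lemma integrable_mul_exp_neg {f : ℝ → ℝ} (hf : Measurable f) (hf0 : ∀ u ≤ 0, f u = 0) {C : ℝ}
    (hfC : ∀ u, 0 < u → |f u| ≤ C * (1 + u)) {δ : ℝ} (hδ : 0 < δ) :
    Integrable fun u => f u * Real.exp (-(δ * u)) := by
  have hC : 0 ≤ C := by
    have := (abs_nonneg _).trans (hfC 1 one_pos)
    linarith
  rw [← integrableOn_univ, ← Set.Iic_union_Ioi (a := (0 : ℝ)), integrableOn_union]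
  constructor
  · exact (integrableOn_zero).congr_fun (fun u hu => by simp [hf0 u hu]) measurableSet_Iic
  · have h1 := (exp_neg_integrableOn_Ioi 0 (half_pos hδ)).const_mul (C * (1 + 2 / δ))
    refine h1.mono' (by fun_prop) ?_
    filter_upwards [ae_restrict_mem measurableSet_Ioi] with u hu
    have hu : 0 < u := hu
    rw [norm_mul, Real.norm_eq_abs, Real.norm_eq_abs, abs_of_pos (Real.exp_pos _)]
    have h2 : 1 + u ≤ (1 + 2 / δ) * Real.exp (δ / 2 * u) := by
      have h3 : δ / 2 * u + 1 ≤ Real.exp (δ / 2 * u) := Real.add_one_le_exp _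
      have h4 : u ≤ 2 / δ * Real.exp (δ / 2 * u) := by
        calc u = 2 / δ * (δ / 2 * u) := by field_simp
          _ ≤ _ := by gcongr; linarith
      have : 0 < δ / 2 * u := by positivity
      linarith
    calc |f u| * Real.exp (-(δ * u)) ≤ C * ((1 + 2 / δ) * Real.exp (δ / 2 * u)) *
          Real.exp (-(δ * u)) := by
          gcongr
          exact (hfC u hu).trans (by gcongr)
      _ = C * (1 + 2 / δ) * (Real.exp (δ / 2 * u) * Real.exp (-(δ * u))) := by ring
      _ = _ := by rw [← Real.exp_add]; ring_nf

lemma integrable_sqrt_mul_exp_neg {δ : ℝ} (hδ : 0 < δ) :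
    MeasureTheory.Integrable fun u : ℝ => √u * Real.exp (-(δ * u)) := by
  refine integrable_mul_exp_neg (C := 1) Real.continuous_sqrt.measurable
    (fun u hu => Real.sqrt_eq_zero_of_nonpos hu) (fun u hu => ?_) hδ
  rw [abs_of_nonneg (Real.sqrt_nonneg u), one_mul]
  exact Real.sqrt_le_iff.2 ⟨by positivity, by nlinarith⟩

/-- Smoothing of `f` at `x` against the dilated Fejér kernel, with a mild exponential damping. -/
noncomputable def fejerMean (f : ℝ → ℝ) (l x : ℝ) : ℝ :=
  ∫ v, f (x - v) * Real.exp (-((x ^ 2)⁻¹ * (x - v))) * (l * fejer (l * v))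

open MeasureTheory in
lemma integrable_fejerMean {f : ℝ → ℝ}
    (hf : ∀ δ : ℝ, 0 < δ → Integrable fun u => f u * Real.exp (-(δ * u)))
    (l : ℝ) {x : ℝ} (hx : x ≠ 0) :
    Integrable fun v => f (x - v) * Real.exp (-((x ^ 2)⁻¹ * (x - v))) * (l * fejer (l * v)) := by
  have h1 := (hf (x ^ 2)⁻¹ (by positivity)).comp_sub_left x
  refine h1.mul_bdd (c := |l|) ?_ (Eventually.of_forall fun v => ?_)
  · have := continuous_fejer
    exact Continuous.aestronglyMeasurable (by fun_prop)
  · rw [norm_mul, Real.norm_eq_abs, Real.norm_eq_abs, abs_of_nonneg (fejer_nonneg _)]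
    exact mul_le_of_le_one_right (abs_nonneg _) (fejer_le_one _)

open MeasureTheory in
lemma fejerMean_eq (f : ℝ → ℝ) (l x : ℝ) :
    fejerMean f l x =
      ∫ u, f u * Real.exp (-((x ^ 2)⁻¹ * u)) * (l * fejer (l * (x - u))) := by
  rw [fejerMean, ← integral_sub_left_eq_self _ volume x]
  simp

open MeasureTheory in
lemma integral_mul_fejer_mul {l : ℝ} (hl : 0 < l) : ∫ v, l * fejer (l * v) = ∫ v, fejer v := by
  rw [integral_const_mul, Measure.integral_comp_mul_left, abs_of_pos (by positivity), smul_eq_mul,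
    mul_inv_cancel_left₀ hl.ne']

open MeasureTheory in
lemma integrable_mul_fejer_mul {l : ℝ} (hl : 0 < l) : Integrable fun v => l * fejer (l * v) :=
  (integrable_fejer.comp_mul_left' hl.ne').const_mul l

lemma sqrt_sub_le {x v : ℝ} (hx : 1 ≤ x) : √(x - v) ≤ √x * (1 + √|v|) := by
  refine Real.sqrt_le_iff.2 ⟨by positivity, ?_⟩
  rw [mul_pow, Real.sq_sqrt (by linarith)]
  have h1 := Real.sq_sqrt (abs_nonneg v)
  have h2 := Real.sqrt_nonneg |v|
  have h3 := neg_abs_le v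
  nlinarith [abs_nonneg v, mul_nonneg (show 0 ≤ x by linarith) h2,
    mul_nonneg (show 0 ≤ x - 1 by linarith) (abs_nonneg v)]

lemma tendsto_inv_sq_mul_sub (v : ℝ) :
    Tendsto (fun x : ℝ => (x ^ 2)⁻¹ * (x - v)) atTop (nhds 0) := by
  have h1 : Tendsto (fun x : ℝ => x⁻¹) atTop (nhds 0) := tendsto_inv_atTop_zero
  have h2 : Tendsto (fun x : ℝ => x⁻¹ - v * x⁻¹ ^ 2) atTop (nhds (0 - v * 0 ^ 2)) :=
    h1.sub ((h1.pow 2).const_mul v)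
  rw [show (0 : ℝ) - v * 0 ^ 2 = 0 by ring] at h2
  refine h2.congr' ?_
  filter_upwards [eventually_gt_atTop 0] with x hx
  field_simp

lemma tendsto_sqrt_sub_div_sqrt (v : ℝ) :
    Tendsto (fun x : ℝ => √(x - v) / √x) atTop (nhds 1) := by
  have h1 : Tendsto (fun x : ℝ => √(1 - v * x⁻¹)) atTop (nhds √(1 - v * 0)) :=
    (tendsto_const_nhds.sub (tendsto_inv_atTop_zero.const_mul v)).sqrt
  rw [mul_zero, sub_zero, Real.sqrt_one] at h1
  refine h1.congr' ?_
  filter_upwards [eventually_gt_atTop 0] with x hx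
  rw [← Real.sqrt_div' _ hx.le]
  congr 1
  field_simp

open MeasureTheory in
lemma integrable_one_add_sqrt_mul_fejer_mul {l : ℝ} (hl : 0 < l) :
    Integrable fun v => (1 + √|v|) * (l * fejer (l * v)) := by
  have hfc := continuous_fejer
  have h1 := (integrable_one_add_sqrt_mul_fejer.comp_mul_left' hl.ne').const_mul
    (l * (1 + √l⁻¹))
  refine h1.mono' (Continuous.aestronglyMeasurable (by fun_prop))
    (Eventually.of_forall fun v => ?_)
  have h0 := fejer_nonneg (l * v)
  rw [Real.norm_eq_abs, abs_of_nonneg (by positivity)]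
  have h2 : √|v| = √l⁻¹ * √|l * v| := by
    rw [← Real.sqrt_mul (by positivity), abs_mul, abs_of_pos hl, inv_mul_cancel_left₀ hl.ne']
  have h3 : 1 + √|v| ≤ (1 + √l⁻¹) * (1 + √|l * v|) := by
    rw [h2]
    nlinarith [Real.sqrt_nonneg l⁻¹, Real.sqrt_nonneg |l * v|]
  calc (1 + √|v|) * (l * fejer (l * v))
      ≤ (1 + √l⁻¹) * (1 + √|l * v|) * (l * fejer (l * v)) := by gcongr
    _ = _ := by ring

open MeasureTheory in
lemma tendsto_fejerMean_sqrt {l : ℝ} (hl : 0 < l) :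
    Tendsto (fun x => fejerMean Real.sqrt l x / √x) atTop (nhds (∫ v, fejer v)) := by
  have hfc := continuous_fejer
  rw [← integral_mul_fejer_mul hl]
  simp_rw [fejerMean, ← integral_div]
  have hb := integrable_one_add_sqrt_mul_fejer_mul hl
  refine tendsto_integral_filter_of_dominated_convergence _ ?_ ?_ hb ?_
  · exact Eventually.of_forall fun x => Continuous.aestronglyMeasurable (by fun_prop)
  · filter_upwards [eventually_ge_atTop 1] with x hx
    refine Eventually.of_forall fun v => ?_
    have h0 := fejer_nonneg (l * v)
    have hx0 : 0 < √x := Real.sqrt_pos.2 (by linarith)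
    rw [Real.norm_eq_abs, abs_of_nonneg (by positivity), div_le_iff₀ hx0,
      mul_right_comm (1 + √|v|)]
    refine mul_le_mul_of_nonneg_right ?_ (mul_nonneg hl.le h0)
    have h1 : √(x - v) * Real.exp (-((x ^ 2)⁻¹ * (x - v))) ≤ √(x - v) := by
      rcases le_total (x - v) 0 with h | h
      · simp [Real.sqrt_eq_zero_of_nonpos h]
      · refine mul_le_of_le_one_right (Real.sqrt_nonneg _) (Real.exp_le_one_iff.2 ?_)
        have : 0 ≤ (x ^ 2)⁻¹ * (x - v) := by positivity
        linarith
    exact h1.trans ((sqrt_sub_le hx).trans_eq (mul_comm _ _))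
  · refine Eventually.of_forall fun v => ?_
    have h1 := ((tendsto_sqrt_sub_div_sqrt v).mul
      (Real.continuous_exp.tendsto _ |>.comp (tendsto_inv_sq_mul_sub v).neg)).mul_const
      (l * fejer (l * v))
    rw [neg_zero, Real.exp_zero, one_mul, one_mul] at h1
    refine h1.congr fun x => ?_
    simp only [Function.comp]
    ring

open MeasureTheory in
lemma tendsto_fejerMean {b : ℝ → ℝ}
    (hb : ∀ δ : ℝ, 0 < δ → Integrable fun u => b u * Real.exp (-(δ * u))) {c : ℝ}
    (hL : ∀ T : ℝ, ∃ M : ℝ, ∀ z : ℂ, 0 < z.re → z.re ≤ 1 → |z.im| ≤ T →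
      ‖∫ u : ℝ, ((b u - c * √u : ℝ) : ℂ) * Complex.exp (-(z * u))‖ ≤ M * ‖z‖ ^ (-(1 / 2) : ℝ))
    {l : ℝ} (hl : 0 < l) :
    Tendsto (fun x => fejerMean b l x / √x) atTop (nhds (c * ∫ v, fejer v)) := by
  have hs : ∀ δ : ℝ, 0 < δ → Integrable fun u : ℝ => √u * Real.exp (-(δ * u)) :=
    fun _ hδ => integrable_sqrt_mul_exp_neg hδ
  have hd : ∀ δ : ℝ, 0 < δ → Integrable fun u : ℝ => (b u - c * √u) * Real.exp (-(δ * u)) :=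
    fun δ hδ => ((hb δ hδ).sub ((hs δ hδ).const_mul c)).congr
      (Eventually.of_forall fun u => by simp only [Pi.sub_apply]; ring)
  obtain ⟨M, hM⟩ := exists_abs_integral_mul_fejer_le hd hL hl
  have h1 : Tendsto (fun x => fejerMean (fun u => b u - c * √u) l x / √x) atTop (nhds 0) := by
    have h2 : Tendsto (fun x : ℝ => M / √x) atTop (nhds 0) :=
      Real.tendsto_sqrt_atTop.const_div_atTop M
    refine squeeze_zero_norm' ?_ h2
    filter_upwards [eventually_ge_atTop 1] with x hx
    rw [norm_div, Real.norm_eq_abs, Real.norm_eq_abs, abs_of_nonneg (Real.sqrt_nonneg x),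
      fejerMean_eq]
    gcongr
    exact hM _ (by positivity) (inv_le_one_of_one_le₀ (one_le_pow₀ hx)) x
  have h3 := h1.add ((tendsto_fejerMean_sqrt hl).const_mul c)
  rw [zero_add] at h3
  refine h3.congr' ?_
  filter_upwards [eventually_gt_atTop 0] with x hx
  rw [mul_div_assoc', ← add_div]
  congr 1
  rw [fejerMean, fejerMean, fejerMean, ← integral_const_mul,
    ← integral_add (integrable_fejerMean hd l hx.ne')
      ((integrable_fejerMean hs l hx.ne').const_mul c)]
  refine integral_congr_ae (Eventually.of_forall fun v => ?_)
  ring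

open MeasureTheory in
lemma tendsto_setIntegral_mul {g : ℝ → ℝ} (hg : Integrable g) {h : ℝ} (hh : 0 < h) :
    Tendsto (fun l : ℝ => ∫ v in Set.Ioc (-h) h, l * g (l * v)) atTop (nhds (∫ v, g v)) := by
  have h1 := intervalIntegral_tendsto_integral hg
    (tendsto_neg_atTop_atBot.comp (tendsto_id.atTop_mul_const hh)) (tendsto_id.atTop_mul_const hh)
  refine h1.congr' ?_
  filter_upwards [eventually_gt_atTop 0] with l hl
  rw [← intervalIntegral.integral_of_le (by linarith), intervalIntegral.integral_const_mul,
    intervalIntegral.integral_comp_mul_left _ hl.ne', smul_eq_mul, mul_inv_cancel_left₀ hl.ne']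
  simp

open MeasureTheory in
lemma eventually_div_sqrt_lt {b : ℝ → ℝ} (hb0 : ∀ u, 0 ≤ b u)
    (hb : ∀ δ : ℝ, 0 < δ → Integrable fun u => b u * Real.exp (-(δ * u)))
    (hmono : Monotone fun u => Real.exp u * b u) {c : ℝ}
    (hlim : ∀ l : ℝ, 0 < l →
      Tendsto (fun x => fejerMean b l x / √x) atTop (nhds (c * ∫ v, fejer v)))
    {a : ℝ} (hca : c < a) : ∀ᶠ y in atTop, b y / √y < a := by
  set κ := ∫ v, fejer v with hκ
  have hκ0 : 0 < κ := integral_fejer_pos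
  obtain ⟨h, hh0, hh⟩ : ∃ h : ℝ, 0 < h ∧ Real.exp (2 * h) * (c * κ) < a * κ := by
    have h1 : Tendsto (fun h : ℝ => Real.exp (2 * h) * (c * κ)) (nhdsWithin 0 (Set.Ioi 0))
        (nhds (Real.exp (2 * 0) * (c * κ))) :=
      (Continuous.tendsto (by fun_prop) 0).mono_left nhdsWithin_le_nhds
    have h2 : Real.exp (2 * 0) * (c * κ) < a * κ := by
      rw [mul_zero, Real.exp_zero, one_mul]
      gcongr
    obtain ⟨h, h3, h4⟩ := ((h1.eventually_lt_const h2).and self_mem_nhdsWithin).exists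
    exact ⟨h, h4, h3⟩
  obtain ⟨l, hl, hl0, hl1⟩ : ∃ l : ℝ, (Real.exp (2 * h) * (c * κ) <
      a * ∫ v in Set.Ioc (-h) h, l * fejer (l * v)) ∧ 0 < l ∧
      0 < ∫ v in Set.Ioc (-h) h, l * fejer (l * v) := by
    have h1 := tendsto_setIntegral_mul integrable_fejer hh0
    obtain ⟨l, h2⟩ := (((h1.const_mul a).eventually_const_lt hh).and
      ((eventually_gt_atTop 0).and (h1.eventually_const_lt hκ0))).exists
    exact ⟨l, h2.1, h2.2.1, h2.2.2⟩
  set K := ∫ v in Set.Ioc (-h) h, l * fejer (l * v) with hK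
  have hshift : Tendsto (fun y : ℝ => y + h) atTop atTop :=
    tendsto_atTop_add_const_right _ _ tendsto_id
  have hT : Tendsto (fun y : ℝ => Real.exp (2 * h) / K * (fejerMean b l (y + h) / √(y + h)) *
      Real.exp (((y + h) ^ 2)⁻¹ * (y + h - -h)) * (√(y - -h) / √y)) atTop
      (nhds (Real.exp (2 * h) / K * (c * κ) * Real.exp 0 * 1)) :=
    ((((hlim l hl0).comp hshift).const_mul _).mul
      ((Real.continuous_exp.tendsto _).comp ((tendsto_inv_sq_mul_sub (-h)).comp hshift))).mul
      (tendsto_sqrt_sub_div_sqrt (-h))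
  have hlt : Real.exp (2 * h) / K * (c * κ) * Real.exp 0 * 1 < a := by
    rw [Real.exp_zero, mul_one, mul_one, div_mul_eq_mul_div, div_lt_iff₀ hl1]
    exact hl
  filter_upwards [hT.eventually_lt_const hlt, eventually_gt_atTop 0] with y hy hy0
  refine lt_of_le_of_lt ?_ hy
  have hyh : 0 < y + h := by linarith
  have hJ : Real.exp (-(2 * h)) * b y * Real.exp (-(((y + h) ^ 2)⁻¹ * (y + h - -h))) * K ≤
      fejerMean b l (y + h) := by
    have hint := integrable_fejerMean hb l hyh.ne'
    rw [hK, ← integral_const_mul, fejerMean]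
    refine le_trans ?_ (setIntegral_le_integral (s := Set.Ioc (-h) h) hint
      (Eventually.of_forall fun v => mul_nonneg (mul_nonneg (hb0 _) (Real.exp_pos _).le)
        (mul_nonneg hl0.le (fejer_nonneg _))))
    refine setIntegral_mono_on ((integrable_mul_fejer_mul hl0).const_mul _).integrableOn
      hint.integrableOn measurableSet_Ioc fun v hv => ?_
    refine mul_le_mul_of_nonneg_right ?_ (mul_nonneg hl0.le (fejer_nonneg _))
    have h1 : Real.exp (-(2 * h)) * b y ≤ b (y + h - v) := by
      have h2 : Real.exp y * b y ≤ Real.exp (y + h - v) * b (y + h - v) :=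
        hmono (by linarith [hv.2])
      have h3 : Real.exp (y + h - v) * b (y + h - v) ≤ Real.exp (y + 2 * h) * b (y + h - v) :=
        mul_le_mul_of_nonneg_right (Real.exp_le_exp.2 (by linarith [hv.1])) (hb0 _)
      have h4 := mul_le_mul_of_nonneg_left (h2.trans h3) (Real.exp_pos (-(y + 2 * h))).le
      rw [← mul_assoc, ← mul_assoc, ← Real.exp_add, ← Real.exp_add] at h4
      simpa using h4
    have h5 : Real.exp (-(((y + h) ^ 2)⁻¹ * (y + h - -h))) ≤
        Real.exp (-(((y + h) ^ 2)⁻¹ * (y + h - v))) := by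
      apply Real.exp_le_exp.2
      apply neg_le_neg
      apply mul_le_mul_of_nonneg_left _ (by positivity)
      linarith [hv.1]
    exact mul_le_mul h1 h5 (Real.exp_pos _).le (hb0 _)
  have hs1 : 0 < √(y + h) := Real.sqrt_pos.2 hyh
  have hs0 : 0 < √y := Real.sqrt_pos.2 hy0
  calc b y / √y = Real.exp (2 * h) / K * ((Real.exp (-(2 * h)) * b y *
        Real.exp (-(((y + h) ^ 2)⁻¹ * (y + h - -h))) * K) / √(y + h)) *
      Real.exp (((y + h) ^ 2)⁻¹ * (y + h - -h)) * (√(y - -h) / √y) := by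
        rw [sub_neg_eq_add, sub_neg_eq_add, Real.exp_neg, Real.exp_neg]
        have := Real.exp_pos (((y + h) ^ 2)⁻¹ * (y + h + h))
        field_simp
    _ ≤ _ := by
        gcongr

open MeasureTheory in
lemma eventually_lt_div_sqrt {b : ℝ → ℝ} (hb0 : ∀ u, 0 ≤ b u) (hbu : ∀ u, b u ≤ max u 0)
    (hb : ∀ δ : ℝ, 0 < δ → Integrable fun u => b u * Real.exp (-(δ * u)))
    (hmono : Monotone fun u => Real.exp u * b u) {c : ℝ}
    (hlim : ∀ l : ℝ, 0 < l →
      Tendsto (fun x => fejerMean b l x / √x) atTop (nhds (c * ∫ v, fejer v)))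
    {a : ℝ} (hac : a < c) : ∀ᶠ y in atTop, a < b y / √y := by
  obtain ⟨A, hA0, hA⟩ : ∃ A : ℝ, 0 ≤ A ∧ ∀ u, b u ≤ A * (1 + √|u|) := by
    obtain ⟨U, hU⟩ := eventually_atTop.1
      (eventually_div_sqrt_lt hb0 hb hmono hlim (lt_add_one c))
    refine ⟨|c + 1| + |U|, by positivity, fun u => ?_⟩
    rcases le_or_gt u 0 with hu | hu
    · refine (hbu u).trans ?_
      rw [max_eq_right hu]
      positivity
    rcases le_or_gt U u with h | h
    · have h1 := (div_lt_iff₀ (Real.sqrt_pos.2 hu)).1 (hU u h)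
      rw [abs_of_pos hu]
      have h2 := Real.sqrt_nonneg u
      nlinarith [le_abs_self (c + 1), abs_nonneg U, abs_nonneg (c + 1)]
    · refine (hbu u).trans ?_
      rw [max_eq_left hu.le]
      have h2 := Real.sqrt_nonneg |u|
      nlinarith [le_abs_self U, abs_nonneg U, abs_nonneg (c + 1), mul_nonneg (abs_nonneg U) h2,
        mul_nonneg (abs_nonneg (c + 1)) h2]
  set κ := ∫ v, fejer v with hκ
  have hκ0 : 0 < κ := integral_fejer_pos
  obtain ⟨h, hh0, hh⟩ : ∃ h : ℝ, 0 < h ∧ a * κ < Real.exp (-(2 * h)) * (c * κ) := by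
    have h1 : Tendsto (fun h : ℝ => Real.exp (-(2 * h)) * (c * κ)) (nhdsWithin 0 (Set.Ioi 0))
        (nhds (Real.exp (-(2 * 0)) * (c * κ))) :=
      (Continuous.tendsto (by fun_prop) 0).mono_left nhdsWithin_le_nhds
    have h2 : a * κ < Real.exp (-(2 * 0)) * (c * κ) := by
      rw [mul_zero, neg_zero, Real.exp_zero, one_mul]
      gcongr
    obtain ⟨h, h3, h4⟩ := ((h1.eventually_const_lt h2).and self_mem_nhdsWithin).exists
    exact ⟨h, h4, h3⟩
  set W : ℝ → ℝ := fun v => (1 + √|v|) * fejer v with hW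
  have hWint : Integrable W := integrable_one_add_sqrt_mul_fejer
  obtain ⟨l, hl1, hl⟩ : ∃ l : ℝ, 1 ≤ l ∧ a * κ < Real.exp (-(2 * h)) *
      (c * κ - 2 * A * ((∫ v, W v) - ∫ v in Set.Ioc (-h) h, l * W (l * v))) := by
    have h1 := ((((tendsto_setIntegral_mul hWint hh0).const_sub (∫ v, W v)).const_mul
      (2 * A)).const_sub (c * κ)).const_mul (Real.exp (-(2 * h)))
    rw [sub_self, mul_zero, sub_zero] at h1
    obtain ⟨l, h2⟩ := ((eventually_ge_atTop 1).and (h1.eventually_const_lt hh)).exists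
    exact ⟨l, h2⟩
  set τ := (∫ v, W v) - ∫ v in Set.Ioc (-h) h, l * W (l * v) with hτ
  have hl0 : 0 < l := by linarith
  have hshift : Tendsto (fun y : ℝ => y - h) atTop atTop :=
    tendsto_atTop_add_const_right _ _ tendsto_id
  have hT : Tendsto (fun y : ℝ => Real.exp (-(2 * h)) / κ *
      (fejerMean b l (y - h) / √(y - h) - 2 * A * τ) * (√(y - h) / √y)) atTop
      (nhds (Real.exp (-(2 * h)) / κ * (c * κ - 2 * A * τ) * 1)) :=
    ((((hlim l hl0).comp hshift).sub_const _).const_mul _).mul (tendsto_sqrt_sub_div_sqrt h)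
  have hlt : a < Real.exp (-(2 * h)) / κ * (c * κ - 2 * A * τ) * 1 := by
    rw [mul_one, div_mul_eq_mul_div, lt_div_iff₀ hκ0]
    exact hl
  filter_upwards [hT.eventually_const_lt hlt, eventually_ge_atTop (1 + h)] with y hy hy0
  refine lt_of_lt_of_le hy ?_
  have hx1 : 1 ≤ y - h := by linarith
  set x := y - h with hx
  have hx0 : x ≠ 0 := by linarith
  have hs0 : 0 < √x := Real.sqrt_pos.2 (by linarith)
  have hs1 : 0 < √y := Real.sqrt_pos.2 (by linarith)
  have hpt : ∀ v, b (x - v) * Real.exp (-((x ^ 2)⁻¹ * (x - v))) ≤ b (x - v) := fun v => by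
    rcases le_total (x - v) 0 with h | h
    · have h1 : b (x - v) = 0 := le_antisymm ((hbu _).trans_eq (max_eq_right h)) (hb0 _)
      rw [h1, zero_mul]
    · refine mul_le_of_le_one_right (hb0 _) (Real.exp_le_one_iff.2 ?_)
      have : 0 ≤ (x ^ 2)⁻¹ * (x - v) := by positivity
      linarith
  have hint := integrable_fejerMean hb l hx0
  have hk0 : ∀ v, 0 ≤ l * fejer (l * v) := fun v => mul_nonneg hl0.le (fejer_nonneg _)
  have hnear : ∫ v in Set.Ioc (-h) h, b (x - v) * Real.exp (-((x ^ 2)⁻¹ * (x - v))) *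
      (l * fejer (l * v)) ≤ Real.exp (2 * h) * b y * κ := by
    rw [hκ, ← integral_mul_fejer_mul hl0, ← integral_const_mul]
    refine le_trans ?_ (setIntegral_le_integral (s := Set.Ioc (-h) h)
      ((integrable_mul_fejer_mul hl0).const_mul _)
      (Eventually.of_forall fun v => mul_nonneg (mul_nonneg (Real.exp_pos _).le (hb0 _)) (hk0 v)))
    refine setIntegral_mono_on hint.integrableOn
      ((integrable_mul_fejer_mul hl0).const_mul _).integrableOn measurableSet_Ioc fun v hv => ?_
    refine mul_le_mul_of_nonneg_right ((hpt v).trans ?_) (hk0 v)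
    have h2 : Real.exp (x - v) * b (x - v) ≤ Real.exp y * b y := hmono (by linarith [hv.1])
    have h3 := mul_le_mul_of_nonneg_left h2 (Real.exp_pos (-(x - v))).le
    rw [← mul_assoc, ← mul_assoc, ← Real.exp_add, ← Real.exp_add, neg_add_cancel, Real.exp_zero,
      one_mul] at h3
    refine h3.trans (mul_le_mul_of_nonneg_right (Real.exp_le_exp.2 ?_) (hb0 _))
    linarith [hv.2]
  have hWl : Integrable fun v => l * W (l * v) := (hWint.comp_mul_left' hl0.ne').const_mul l
  have hfar : ∫ v in (Set.Ioc (-h) h)ᶜ, b (x - v) * Real.exp (-((x ^ 2)⁻¹ * (x - v))) *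
      (l * fejer (l * v)) ≤ 2 * A * √x * τ := by
    have h1 : τ = ∫ v in (Set.Ioc (-h) h)ᶜ, l * W (l * v) := by
      have h2 := integral_add_compl (s := Set.Ioc (-h) h) measurableSet_Ioc hWl
      have h3 : ∫ v, l * W (l * v) = ∫ v, W v := by
        rw [integral_const_mul, Measure.integral_comp_mul_left, abs_of_pos (by positivity),
          smul_eq_mul, mul_inv_cancel_left₀ hl0.ne']
      rw [hτ, ← h3, ← h2, add_sub_cancel_left]
    rw [h1, ← integral_const_mul]
    refine setIntegral_mono hint.integrableOn (hWl.const_mul _).integrableOn fun v => ?_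
    have h2 : b (x - v) ≤ 2 * A * √x * (1 + √|v|) := by
      rcases le_total (x - v) 0 with h | h
      · refine ((hbu _).trans_eq (max_eq_right h)).trans ?_
        positivity
      · have h3 := hA (x - v)
        rw [abs_of_nonneg h] at h3
        have h4 := sqrt_sub_le (v := v) hx1
        have h5 : 1 ≤ √x * (1 + √|v|) := by
          have : 1 ≤ √x := Real.one_le_sqrt.2 hx1
          nlinarith [Real.sqrt_nonneg |v|]
        calc b (x - v) ≤ A * (1 + √(x - v)) := h3
          _ ≤ A * (√x * (1 + √|v|) + √x * (1 + √|v|)) := by gcongr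
          _ = _ := by ring
    have h6 : 1 + √|v| ≤ 1 + √|l * v| := by
      refine add_le_add_right (Real.sqrt_le_sqrt ?_) 1
      rw [abs_mul, abs_of_pos hl0]
      exact le_mul_of_one_le_left (abs_nonneg v) hl1
    calc b (x - v) * Real.exp (-((x ^ 2)⁻¹ * (x - v))) * (l * fejer (l * v))
        ≤ 2 * A * √x * (1 + √|l * v|) * (l * fejer (l * v)) := by
          refine mul_le_mul_of_nonneg_right ((hpt v).trans (h2.trans ?_)) (hk0 v)
          gcongr
      _ = 2 * A * √x * (l * W (l * v)) := by simp only [hW]; ring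
  have hJ : fejerMean b l x ≤ Real.exp (2 * h) * b y * κ + 2 * A * √x * τ := by
    rw [fejerMean, ← integral_add_compl (s := Set.Ioc (-h) h) measurableSet_Ioc hint]
    exact add_le_add hnear hfar
  have h7 : fejerMean b l x / √x - 2 * A * τ ≤ Real.exp (2 * h) * b y * κ / √x := by
    rw [sub_le_iff_le_add, div_add' _ _ _ hs0.ne']
    gcongr
    linarith
  calc Real.exp (-(2 * h)) / κ * (fejerMean b l x / √x - 2 * A * τ) * (√x / √y)
      ≤ Real.exp (-(2 * h)) / κ * (Real.exp (2 * h) * b y * κ / √x) * (√x / √y) := by gcongr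
    _ = b y / √y := by
      rw [Real.exp_neg]
      field_simp

/-- A Tauberian theorem of Wiener-Ikehara type for a square-root singularity. -/
lemma tendsto_div_sqrt_of_laplace {b : ℝ → ℝ} (hb0 : ∀ u, 0 ≤ b u) (hbu : ∀ u, b u ≤ max u 0)
    (hmono : Monotone fun u => Real.exp u * b u) {c : ℝ}
    (hL : ∀ T : ℝ, ∃ M : ℝ, ∀ z : ℂ, 0 < z.re → z.re ≤ 1 → |z.im| ≤ T →
      ‖∫ u : ℝ, ((b u - c * √u : ℝ) : ℂ) * Complex.exp (-(z * u))‖ ≤ M * ‖z‖ ^ (-(1 / 2) : ℝ)) :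
    Tendsto (fun u => b u / √u) atTop (nhds c) := by
  have hm : Measurable b := by
    have h1 : Measurable fun u => Real.exp (-u) * (Real.exp u * b u) :=
      (by fun_prop : Measurable fun u : ℝ => Real.exp (-u)).mul hmono.measurable
    simpa [← mul_assoc, ← Real.exp_add] using h1
  have hb : ∀ δ : ℝ, 0 < δ → MeasureTheory.Integrable fun u => b u * Real.exp (-(δ * u)) :=
    fun δ hδ => by
    refine integrable_mul_exp_neg (C := 1) hm
      (fun u hu => le_antisymm ((hbu u).trans_eq (max_eq_right hu)) (hb0 u)) (fun u hu => ?_) hδ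
    rw [abs_of_nonneg (hb0 u)]
    have := (hbu u).trans_eq (max_eq_left hu.le)
    linarith
  have hlim := fun (l : ℝ) (hl : 0 < l) => tendsto_fejerMean hb hL hl
  exact tendsto_order.2 ⟨fun a ha => eventually_lt_div_sqrt hb0 hbu hb hmono hlim ha,
    fun a ha => eventually_div_sqrt_lt hb0 hb hmono hlim ha⟩

open MeasureTheory in
lemma hasDerivAt_integral_mul_exp_neg {g : ℝ → ℝ} (hg : Measurable g)
    (hgi : ∀ δ : ℝ, 0 < δ → IntegrableOn (fun u => g u * Real.exp (-(δ * u))) (Set.Ioi 0))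
    {z : ℂ} (hz : 0 < z.re) :
    HasDerivAt (fun z : ℂ => ∫ u in Set.Ioi (0 : ℝ), (g u : ℂ) * Complex.exp (-(z * u)))
      (-∫ u in Set.Ioi (0 : ℝ), ((u * g u : ℝ) : ℂ) * Complex.exp (-(z * u))) z := by
  have hs : {w : ℂ | z.re / 2 < w.re} ∈ nhds z :=
    (isOpen_lt continuous_const Complex.continuous_re).mem_nhds (half_lt_self hz)
  have hgC : Measurable fun u => (g u : ℂ) := Complex.measurable_ofReal.comp hg
  have hm : ∀ w : ℂ, AEStronglyMeasurable (fun u : ℝ => (g u : ℂ) * Complex.exp (-(w * u)))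
      (volume.restrict (Set.Ioi 0)) := fun w => (by fun_prop :
        Measurable fun u : ℝ => (g u : ℂ) * Complex.exp (-(w * u))).aestronglyMeasurable
  have hnorm : ∀ (w : ℂ) (u : ℝ), ‖Complex.exp (-(w * u))‖ = Real.exp (-(w.re * u)) := by
    intro w u
    rw [Complex.norm_exp]
    simp
  have hb : IntegrableOn (fun u : ℝ => 4 / z.re * ‖g u * Real.exp (-(z.re / 4 * u))‖)
      (Set.Ioi 0) := (hgi _ (by positivity)).norm.const_mul _
  have h := (hasDerivAt_integral_of_dominated_loc_of_deriv_le (μ := volume.restrict (Set.Ioi 0))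
    (F := fun (w : ℂ) (u : ℝ) => (g u : ℂ) * Complex.exp (-(w * u)))
    (F' := fun (w : ℂ) (u : ℝ) => -(((u * g u : ℝ) : ℂ) * Complex.exp (-(w * u))))
    (bound := fun u => 4 / z.re * ‖g u * Real.exp (-(z.re / 4 * u))‖) hs
    (Eventually.of_forall hm) ?_ ?_ ?_ hb ?_).2
  · rwa [integral_neg] at h
  · refine (hgi _ hz).norm.mono' (hm z) (Eventually.of_forall fun u => ?_)
    rw [norm_mul, hnorm, norm_mul, Complex.norm_real, Real.norm_of_nonneg (Real.exp_pos _).le]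
  · exact (by fun_prop : Measurable fun u : ℝ =>
      -(((u * g u : ℝ) : ℂ) * Complex.exp (-(z * u)))).aestronglyMeasurable
  · filter_upwards [ae_restrict_mem measurableSet_Ioi] with u hu w hw
    have hu : 0 < u := hu
    have hw : z.re / 2 < w.re := hw
    rw [norm_neg, norm_mul, hnorm, Complex.norm_real, norm_mul, norm_mul,
      Real.norm_of_nonneg hu.le, Real.norm_of_nonneg (Real.exp_pos _).le]
    have h1 : u * Real.exp (-(w.re * u)) ≤ 4 / z.re * Real.exp (-(z.re / 4 * u)) := by
      have h2 : z.re / 4 * u ≤ Real.exp (z.re / 4 * u) := by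
        linarith [Real.add_one_le_exp (z.re / 4 * u)]
      calc u * Real.exp (-(w.re * u)) ≤ u * Real.exp (-(z.re / 2 * u)) := by gcongr
        _ = 4 / z.re * (z.re / 4 * u) * Real.exp (-(z.re / 2 * u)) := by field_simp
        _ ≤ 4 / z.re * Real.exp (z.re / 4 * u) * Real.exp (-(z.re / 2 * u)) := by gcongr
        _ = _ := by rw [mul_assoc, ← Real.exp_add]; ring_nf
    calc u * ‖g u‖ * Real.exp (-(w.re * u)) = ‖g u‖ * (u * Real.exp (-(w.re * u))) := by ring
      _ ≤ ‖g u‖ * (4 / z.re * Real.exp (-(z.re / 4 * u))) := by gcongr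
      _ = _ := by ring
  · refine Eventually.of_forall fun u w _ => ?_
    have h1 : HasDerivAt (fun w : ℂ => -(w * u)) (-(1 * u)) w :=
      ((hasDerivAt_id w).mul_const (u : ℂ)).neg
    refine (h1.cexp.const_mul (g u : ℂ)).congr_deriv ?_
    push_cast
    ring

open MeasureTheory in
lemma integral_sqrt_mul_exp_neg {z : ℂ} (hz : 0 < z.re) :
    ∫ u in Set.Ioi (0 : ℝ), ((√u : ℝ) : ℂ) * Complex.exp (-(z * u)) =
      Real.Gamma (3 / 2) * z ^ (-(3 / 2) : ℂ) := by
  have hopen : IsOpen {z : ℂ | 0 < z.re} := isOpen_lt continuous_const Complex.continuous_re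
  have hconv : Convex ℝ {z : ℂ | 0 < z.re} := convex_halfSpace_re_gt 0
  have h1 : DifferentiableOn ℂ (fun z : ℂ => ∫ u in Set.Ioi (0 : ℝ), ((√u : ℝ) : ℂ) *
      Complex.exp (-(z * u))) {z | 0 < z.re} := fun w hw =>
    (hasDerivAt_integral_mul_exp_neg Real.continuous_sqrt.measurable
      (fun δ hδ => (integrable_sqrt_mul_exp_neg hδ).integrableOn) hw)
      |>.differentiableAt.differentiableWithinAt
  have h2 : DifferentiableOn ℂ (fun z : ℂ => Real.Gamma (3 / 2) * z ^ (-(3 / 2) : ℂ))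
      {z | 0 < z.re} := fun w hw =>
    ((differentiableAt_id.cpow_const (Or.inl hw)).const_mul _).differentiableWithinAt
  have hreal : ∀ x : ℝ, 0 < x → (∫ u in Set.Ioi (0 : ℝ), ((√u : ℝ) : ℂ) *
      Complex.exp (-((x : ℂ) * u))) = Real.Gamma (3 / 2) * (x : ℂ) ^ (-(3 / 2) : ℂ) := by
    intro x hx
    have h3 := Complex.integral_cpow_mul_exp_neg_mul_Ioi (a := 3 / 2) (r := x) (by norm_num) hx
    rw [one_div, Complex.inv_cpow _ _ (by
      rw [Complex.arg_ofReal_of_nonneg hx.le]; exact Real.pi_pos.ne), ← Complex.cpow_neg] at h3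
    rw [← Complex.Gamma_ofReal, mul_comm]
    push_cast
    rw [← h3]
    refine setIntegral_congr_fun measurableSet_Ioi fun u hu => ?_
    have hu : 0 < u := hu
    rw [Real.sqrt_eq_rpow, Complex.ofReal_cpow hu.le]
    norm_num
  refine (h1.analyticOnNhd hopen).eqOn_of_preconnected_of_frequently_eq (h2.analyticOnNhd hopen)
    hconv.isPreconnected (z₀ := 1) (by simp) ?_ hz
  have h4 : Tendsto (fun n : ℕ => ((1 + 1 / ((n : ℝ) + 1) : ℝ) : ℂ)) atTop (nhdsWithin 1 {1}ᶜ) := by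
    refine tendsto_nhdsWithin_iff.2 ⟨?_, Eventually.of_forall fun n => ?_⟩
    · have := (tendsto_one_div_add_atTop_nhds_zero_nat (𝕜 := ℝ)).const_add 1
      rw [add_zero] at this
      exact_mod_cast (Complex.continuous_ofReal.tendsto 1).comp this
    · have : (0 : ℝ) < 1 / ((n : ℝ) + 1) := by positivity
      rw [Set.mem_compl_singleton_iff]
      exact_mod_cast (by linarith : (1 + 1 / ((n : ℝ) + 1)) ≠ 1)
  exact h4.frequently (Frequently.of_forall fun n => hreal _ (by positivity))

/-- The number of split squarefree positive integers up to `x`. -/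
noncomputable def splitCount (x : ℝ) : ℝ := ∑ k ∈ Finset.Icc 1 ⌊x⌋₊, splitIndicator k

lemma splitCount_nonneg (x : ℝ) : 0 ≤ splitCount x :=
  Finset.sum_nonneg fun k _ => splitIndicator_nonneg k

lemma sum_splitIndicator_le (n : ℕ) : ∑ k ∈ Finset.Icc 1 n, splitIndicator k ≤ n := by
  refine (Finset.sum_le_sum fun k _ => splitIndicator_le_one k).trans_eq ?_
  simp

lemma splitCount_le {x : ℝ} (hx : 0 ≤ x) : splitCount x ≤ x :=
  (sum_splitIndicator_le _).trans (Nat.floor_le hx)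

lemma monotone_splitCount : Monotone splitCount := fun _ _ h =>
  Finset.sum_le_sum_of_subset_of_nonneg (Finset.Icc_subset_Icc_right (Nat.floor_le_floor h))
    fun k _ _ => splitIndicator_nonneg k

open MeasureTheory in
lemma LSeries_splitIndicator_div {z : ℂ} (hz : 0 < z.re) :
    LSeries (fun n => (splitIndicator n : ℂ)) (1 + z) / (1 + z) =
      ∫ u in Set.Ioi (0 : ℝ), ((splitCount (Real.exp u) * Real.exp (-u) : ℝ) : ℂ) *
        Complex.exp (-(z * u)) := by
  have h0 : 1 + z ≠ 0 := fun h => by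
    have := congrArg Complex.re h
    simp at this
    linarith
  rw [LSeries_eq_mul_integral_of_nonneg splitIndicator (r := 1) zero_le_one (by simpa using hz) ?_
    splitIndicator_nonneg, mul_div_cancel_left₀ _ h0]
  · rw [← Real.exp_zero, ← integral_comp_exp_Ioi]
    refine setIntegral_congr_fun measurableSet_Ioi fun u _ => ?_
    simp only [splitCount]
    rw [Complex.cpow_def_of_ne_zero (by exact_mod_cast (Real.exp_pos u).ne'), ← Complex.ofReal_log
      (Real.exp_pos u).le, Real.log_exp, Complex.real_smul, mul_left_comm]
    push_cast
    rw [← Complex.exp_add, mul_assoc, ← Complex.exp_add]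
    congr 2
    ring
  · refine Asymptotics.IsBigO.of_bound 1 (Eventually.of_forall fun n => ?_)
    rw [Real.rpow_one, Real.norm_eq_abs, abs_of_nonneg
      (Finset.sum_nonneg fun k _ => splitIndicator_nonneg k), one_mul, Real.norm_natCast]
    exact sum_splitIndicator_le n

open MeasureTheory in
/-- Landau's theorem for split squarefree numbers. -/
lemma exists_tendsto_splitCount :
    ∃ C : ℝ, 0 < C ∧
      Tendsto (fun x : ℝ => splitCount x * √(Real.log x) / x) atTop (nhds C) := by
  obtain ⟨Z, hZ, hZ0, hZL⟩ := exists_LSeries_splitIndicator_sq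
  set g : ℝ → ℝ := fun u => splitCount (Real.exp u) * Real.exp (-u) with hg
  have hgm : Measurable g := (monotone_splitCount.measurable.comp Real.measurable_exp).mul
    (by fun_prop)
  have hg0 : ∀ u, 0 ≤ g u := fun u => mul_nonneg (splitCount_nonneg _) (Real.exp_pos _).le
  have hg1 : ∀ u, g u ≤ 1 := fun u => by
    refine (mul_le_mul_of_nonneg_right (splitCount_le (Real.exp_pos u).le)
      (Real.exp_pos _).le).trans_eq ?_
    rw [← Real.exp_add, add_neg_cancel, Real.exp_zero]
  have hgi : ∀ δ : ℝ, 0 < δ → IntegrableOn (fun u => g u * Real.exp (-(δ * u))) (Set.Ioi 0) := by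
    refine fun δ hδ => (exp_neg_integrableOn_Ioi 0 hδ).mono' (by fun_prop)
      (Eventually.of_forall fun u => ?_)
    rw [Real.norm_of_nonneg (mul_nonneg (hg0 u) (Real.exp_pos _).le), neg_mul]
    exact mul_le_of_le_one_left (Real.exp_pos _).le (hg1 u)
  set Φ : ℂ → ℂ := fun z => ∫ u in Set.Ioi (0 : ℝ), (g u : ℂ) * Complex.exp (-(z * u)) with hΦ
  have hΦd : ∀ z : ℂ, 0 < z.re → HasDerivAt Φ
      (-∫ u in Set.Ioi (0 : ℝ), ((u * g u : ℝ) : ℂ) * Complex.exp (-(z * u))) z :=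
    fun z hz => hasDerivAt_integral_mul_exp_neg hgm hgi hz
  have hne : ∀ z : ℂ, -(1 / 2) < z.re → 1 + z ≠ 0 := fun z hz h => by
    have := congrArg Complex.re h
    simp at this
    linarith
  obtain ⟨c, hc, hcM⟩ := exists_norm_neg_deriv_sub_le (Φ := Φ)
    (Y := fun z => Z (1 + z) / (1 + z) ^ 2)
    (fun z hz => (hΦd z hz).differentiableAt.differentiableWithinAt)
    (by
      refine DifferentiableOn.div (hZ.comp (by fun_prop) fun z hz => ?_) (by fun_prop)
        fun z hz => pow_ne_zero 2 (hne z hz)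
      have hz : -(1 / 2) < z.re := hz
      change 1 / 2 < (1 + z).re
      rw [Complex.add_re, Complex.one_re]
      linarith)
    (fun z hz => div_ne_zero (hZ0 _ (by simpa using hz)) (pow_ne_zero 2 (hne z (by linarith))))
    (fun z hz => by
      have h : _ = Φ z := LSeries_splitIndicator_div hz
      rw [← h, ← hZL (1 + z) (by simpa using hz), div_pow,
        add_sub_cancel_left, div_mul_eq_mul_div])
    (fun x hx => by
      refine ⟨∫ u in Set.Ioi (0 : ℝ), g u * Real.exp (-(x * u)),
        integral_nonneg fun u => mul_nonneg (hg0 u) (Real.exp_pos _).le, ?_⟩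
      rw [← integral_complex_ofReal]
      push_cast
      rfl)
  have hG : 0 < Real.Gamma (3 / 2) := Real.Gamma_pos_of_pos (by norm_num)
  refine ⟨c / Real.Gamma (3 / 2), div_pos hc hG, ?_⟩
  set C := c / Real.Gamma (3 / 2) with hC
  have hT := tendsto_div_sqrt_of_laplace (b := fun u => max u 0 * g u) (c := C)
    (fun u => mul_nonneg (le_max_right _ _) (hg0 u))
    (fun u => mul_le_of_le_one_right (le_max_right _ _) (hg1 u))
    (by
      have h : (fun u => Real.exp u * (max u 0 * g u)) =
          fun u => max u 0 * splitCount (Real.exp u) := by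
        funext u
        rw [hg, mul_left_comm, mul_left_comm (Real.exp u), ← Real.exp_add, add_neg_cancel,
          Real.exp_zero, mul_one]
      rw [h]
      exact Monotone.mul (fun _ _ h => max_le_max_right 0 h)
        (monotone_splitCount.comp Real.exp_monotone) (fun _ => le_max_right _ _)
        fun _ => splitCount_nonneg _)
    (fun T => by
      obtain ⟨M, hM⟩ := hcM T
      refine ⟨M, fun z hz hz1 hzT => ?_⟩
      convert hM z hz hz1 hzT using 2
      rw [(hΦd z hz).deriv, neg_neg]
      have h1 : ∫ u : ℝ, ((max u 0 * g u - C * √u : ℝ) : ℂ) * Complex.exp (-(z * u)) =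
          ∫ u in Set.Ioi (0 : ℝ), (((u * g u : ℝ) : ℂ) * Complex.exp (-(z * u)) -
            C * (((√u : ℝ) : ℂ) * Complex.exp (-(z * u)))) := by
        rw [← setIntegral_eq_integral_of_forall_compl_eq_zero (s := Set.Ioi (0 : ℝ))]
        · refine setIntegral_congr_fun measurableSet_Ioi fun u hu => ?_
          simp only [max_eq_left (le_of_lt (Set.mem_Ioi.1 hu))]
          push_cast
          ring
        · intro u hu
          have hu : u ≤ 0 := not_lt.1 hu
          simp [max_eq_right hu, Real.sqrt_eq_zero_of_nonpos hu]
      have hexp : ∀ f : ℝ → ℝ, Measurable f → Integrable (fun u => f u * Real.exp (-(z.re * u))) →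
          IntegrableOn (fun u : ℝ => (f u : ℂ) * Complex.exp (-(z * u))) (Set.Ioi 0) := by
        intro f hfm hf
        refine (hf.norm.mono' (Measurable.aestronglyMeasurable ?_)
          (Eventually.of_forall fun u => ?_)).integrableOn
        · have := Complex.measurable_ofReal.comp hfm
          exact this.mul (by fun_prop)
        · rw [norm_mul, norm_mul, Complex.norm_real, Complex.norm_exp,
            Real.norm_of_nonneg (Real.exp_pos _).le]
          simp
      rw [h1, integral_sub, integral_const_mul, integral_sqrt_mul_exp_neg hz, ← mul_assoc]
      · congr 2
        rw [hC, ← Complex.ofReal_mul, div_mul_cancel₀ _ hG.ne']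
      · refine (hexp (fun u => max u 0 * g u) (by fun_prop) ?_).congr_fun (fun u hu => ?_)
          measurableSet_Ioi
        · refine integrable_mul_exp_neg (C := 1) (by fun_prop) (fun u hu => ?_) (fun u hu => ?_) hz
          · rw [max_eq_right hu, zero_mul]
          · rw [max_eq_left hu.le, abs_of_nonneg (mul_nonneg hu.le (hg0 u)), one_mul]
            linarith [mul_le_of_le_one_right hu.le (hg1 u)]
        · simp only [max_eq_left (le_of_lt (Set.mem_Ioi.1 hu))]
      · exact (hexp _ Real.continuous_sqrt.measurable
          (integrable_sqrt_mul_exp_neg hz)).const_mul _)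
  refine (hT.comp Real.tendsto_log_atTop).congr' ?_
  filter_upwards [eventually_gt_atTop 1] with x hx
  have hx0 : 0 < x := by linarith
  have hlog : 0 < Real.log x := Real.log_pos hx
  simp only [Function.comp, hg]
  rw [max_eq_left hlog.le, Real.exp_neg, Real.exp_log hx0, mul_div_right_comm, Real.div_sqrt]
  ring

lemma IsSplitSquarefree.mod_four {n : ℕ} (hn : IsSplitSquarefree n) : n % 4 = 1 := by
  have h : ∀ m : ℕ, m ≠ 0 → (∀ p : ℕ, p.Prime → p ∣ m → p % 4 = 1) → m % 4 = 1 := by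
    intro m
    induction m using induction_on_primes with
    | zero => exact fun h _ => absurd rfl h
    | one => exact fun _ _ => rfl
    | prime_mul p a hp ih =>
      intro h0 h
      rw [Nat.mul_mod, h p hp (dvd_mul_right _ _), ih (right_ne_zero_of_mul h0)
        fun q hq hqa => h q hq (hqa.mul_left p)]
  exact h n hn.1.ne_zero hn.2

lemma isSplitSquarefree_or_two_mul_iff {n : ℕ} :
    (Squarefree n ∧ ∀ p : ℕ, p.Prime → p ∣ n → p % 4 ≠ 3) ↔
      IsSplitSquarefree n ∨ ∃ m, IsSplitSquarefree m ∧ n = 2 * m := by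
  have key : ∀ m p : ℕ, p.Prime → p % 4 ≠ 3 → p ∣ m → m % 2 = 1 → p % 4 = 1 := by
    intro m p hp h3 hpm hm
    rcases hp.eq_two_or_odd with h | h
    · subst h
      omega
    · omega
  constructor
  · rintro ⟨hsq, h⟩
    rcases Nat.mod_two_eq_zero_or_one n with h2 | h2
    · obtain ⟨m, rfl⟩ := Nat.dvd_of_mod_eq_zero h2
      refine Or.inr ⟨m, ⟨hsq.of_mul_right, fun p hp hpm => ?_⟩, rfl⟩
      refine key m p hp (h p hp (hpm.mul_left 2)) hpm ?_
      by_contra hm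
      obtain ⟨k, rfl⟩ : 2 ∣ m := by omega
      have := Nat.isUnit_iff.1 (hsq 2 ⟨k, by ring⟩)
      omega
    · exact Or.inl ⟨hsq, fun p hp hpn => key n p hp (h p hp hpn) hpn h2⟩
  · rintro (h | ⟨m, hm, rfl⟩)
    · exact ⟨h.1, fun p hp hpn => by rw [h.2 p hp hpn]; omega⟩
    · have hm4 := hm.mod_four
      refine ⟨(Nat.squarefree_mul ?_).2 ⟨Nat.prime_two.squarefree, hm.1⟩, fun p hp hpn => ?_⟩
      · exact (Nat.coprime_two_left).2 (Nat.odd_iff.2 (by omega))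
      · rcases (hp.dvd_mul).1 hpn with h | h
        · rw [(Nat.prime_dvd_prime_iff_eq hp Nat.prime_two).1 h]
          omega
        · rw [hm.2 p hp h]
          omega

lemma exists_int_sq_add_sq_iff (n : ℕ) :
    (∃ a b : ℤ, (n : ℤ) = a ^ 2 + b ^ 2) ↔ ∃ a b : ℕ, n = a ^ 2 + b ^ 2 := by
  constructor
  · rintro ⟨a, b, h⟩
    refine ⟨a.natAbs, b.natAbs, ?_⟩
    zify
    simpa using h
  · rintro ⟨a, b, h⟩
    exact ⟨a, b, by exact_mod_cast h⟩

lemma squarefree_sum_two_squares_iff {n : ℕ} (hn : Squarefree n) {k : ℕ} (hk : k = 1 ∨ k = 4) :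
    (∃ a b : ℕ, k * n = a ^ 2 + b ^ 2) ↔ ∀ p : ℕ, p.Prime → p ∣ n → p % 4 ≠ 3 := by
  have hval : ∀ q : ℕ, q.Prime → q % 4 = 3 → padicValNat q (k * n) = padicValNat q n := by
    intro q hq hq3
    have := Fact.mk hq
    rw [padicValNat.mul (by omega) hn.ne_zero, padicValNat.eq_zero_of_not_dvd, zero_add]
    rcases hk with rfl | rfl
    · exact hq.not_dvd_one
    · intro h
      have := (Nat.prime_dvd_prime_iff_eq hq Nat.prime_two).1 (hq.dvd_of_dvd_pow (n := 2) h)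
      omega
  rw [Nat.eq_sq_add_sq_iff]
  constructor
  · intro h p hp hpn h3
    have := Fact.mk hp
    have hpk : p ∈ (k * n).primeFactors := Nat.mem_primeFactors.2
      ⟨hp, hpn.mul_left k, mul_ne_zero (by omega) hn.ne_zero⟩
    have h1 := h p hpk h3
    rw [hval p hp h3] at h1
    have h2 : padicValNat p n ≤ 1 := by
      rw [← Nat.factorization_def n hp]
      exact hn.natFactorization_le_one p
    have h3 : 1 ≤ padicValNat p n := one_le_padicValNat_of_dvd hn.ne_zero hpn
    obtain ⟨r, hr⟩ := h1
    omega
  · intro h q hq h3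
    have hqp := Nat.prime_of_mem_primeFactors hq
    rw [hval q hqp h3, padicValNat.eq_zero_of_not_dvd fun hd => h q hqp hd h3]
    exact Even.zero

/-- A squarefree `d` has discriminant a sum of two squares exactly when it is, up to an even factor
and a sign, a split squarefree number. -/
lemma discriminant_sum_two_squares_iff {d D : ℤ} (hD : D = if d % 4 = 1 then d else 4 * d) (B : ℕ) :
    (Squarefree d ∧ d ≠ 0 ∧ d ≠ 1 ∧ |D| ≤ (B : ℤ) ∧ ∃ a b : ℤ, |D| = a ^ 2 + b ^ 2) ↔
      (∃ m : ℕ, IsSplitSquarefree m ∧ m ≠ 1 ∧ m ≤ B ∧ (m : ℤ) = d) ∨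
      (∃ m : ℕ, IsSplitSquarefree m ∧ m ≤ B / 4 ∧ -(m : ℤ) = d) ∨
      (∃ m : ℕ, IsSplitSquarefree m ∧ m ≤ B / 8 ∧ 2 * (m : ℤ) = d) ∨
      (∃ m : ℕ, IsSplitSquarefree m ∧ m ≤ B / 8 ∧ -(2 * (m : ℤ)) = d) := by
  obtain ⟨k, hk, hkd, hDk⟩ : ∃ k : ℕ, (k = 1 ∨ k = 4) ∧ (k = 1 ↔ d % 4 = 1) ∧
      |D| = ((k * d.natAbs : ℕ) : ℤ) := by
    by_cases h : d % 4 = 1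
    · refine ⟨1, Or.inl rfl, by simp [h], ?_⟩
      rw [hD, if_pos h]
      simp
    · refine ⟨4, Or.inr rfl, by simp [h], ?_⟩
      rw [hD, if_neg h, abs_mul]
      simp
  rw [hDk, exists_int_sq_add_sq_iff, ← Int.squarefree_natAbs, Nat.cast_le]
  have h1 : (Squarefree d.natAbs ∧ d ≠ 0 ∧ d ≠ 1 ∧ k * d.natAbs ≤ B ∧
      ∃ a b : ℕ, k * d.natAbs = a ^ 2 + b ^ 2) ↔ (d ≠ 1 ∧ k * d.natAbs ≤ B) ∧
      (Squarefree d.natAbs ∧ ∀ p : ℕ, p.Prime → p ∣ d.natAbs → p % 4 ≠ 3) := by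
    constructor
    · rintro ⟨h1, -, h3, h4, h5⟩
      exact ⟨⟨h3, h4⟩, h1, (squarefree_sum_two_squares_iff h1 hk).1 h5⟩
    · rintro ⟨⟨h3, h4⟩, h1, h5⟩
      exact ⟨h1, by rintro rfl; simp at h1, h3, h4, (squarefree_sum_two_squares_iff h1 hk).2 h5⟩
  rw [h1, isSplitSquarefree_or_two_mul_iff]
  constructor
  · rintro ⟨⟨hd1, hB⟩, h | ⟨m, hm, h⟩⟩
    · have h4 := h.mod_four
      rcases le_total 0 d with hd | hd
      · refine Or.inl ⟨d.natAbs, h, by omega, ?_, by omega⟩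
        rcases hk with rfl | rfl <;> omega
      · refine Or.inr (Or.inl ⟨d.natAbs, h, ?_, by omega⟩)
        rcases hk with rfl | rfl <;> omega
    · have h4 := hm.mod_four
      rcases le_total 0 d with hd | hd
      · refine Or.inr (Or.inr (Or.inl ⟨m, hm, ?_, by omega⟩))
        rcases hk with rfl | rfl <;> omega
      · refine Or.inr (Or.inr (Or.inr ⟨m, hm, ?_, by omega⟩))
        rcases hk with rfl | rfl <;> omega
  · rintro (⟨m, hm, h1, hB, rfl⟩ | ⟨m, hm, hB, rfl⟩ | ⟨m, hm, hB, rfl⟩ | ⟨m, hm, hB, rfl⟩) <;>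
      have h4 := hm.mod_four
    · refine ⟨⟨by omega, ?_⟩, Or.inl (by simpa using hm)⟩
      rcases hk with rfl | rfl <;> omega
    · refine ⟨⟨by omega, ?_⟩, Or.inl (by simpa using hm)⟩
      rcases hk with rfl | rfl <;> omega
    · refine ⟨⟨by omega, ?_⟩, Or.inr ⟨m, hm, by omega⟩⟩
      rcases hk with rfl | rfl <;> omega
    · refine ⟨⟨by omega, ?_⟩, Or.inr ⟨m, hm, by omega⟩⟩
      rcases hk with rfl | rfl <;> omega

open Classical in
lemma splitCount_div (B k : ℕ) :
    splitCount ((B : ℝ) / k) = ((Finset.Icc 1 (B / k)).filter IsSplitSquarefree).card := by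
  rw [splitCount, Nat.floor_div_natCast, Nat.floor_natCast, Finset.card_filter]
  push_cast
  rfl

open Classical in
lemma ncard_discriminant_sum_two_squares {D : ℤ → ℤ}
    (hD : ∀ d : ℤ, D d = if d % 4 = 1 then d else 4 * d) {B : ℕ} (hB : 1 ≤ B) :
    (Set.ncard {d : ℤ | Squarefree d ∧ d ≠ 0 ∧ d ≠ 1 ∧
      |D d| ≤ (B : ℤ) ∧ ∃ a b : ℤ, |D d| = a ^ 2 + b ^ 2} : ℝ) =
      splitCount B - 1 + splitCount ((B : ℝ) / 4) + 2 * splitCount ((B : ℝ) / 8) := by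
  set G : ℕ → Finset ℕ := fun X => (Finset.Icc 1 X).filter IsSplitSquarefree with hG
  have hmem : ∀ X m, m ∈ G X ↔ IsSplitSquarefree m ∧ m ≤ X := by
    intro X m
    simp only [hG, Finset.mem_filter, Finset.mem_Icc]
    constructor
    · rintro ⟨⟨-, h⟩, h2⟩
      exact ⟨h2, h⟩
    · rintro ⟨h, h2⟩
      have := h.mod_four
      exact ⟨⟨by omega, h2⟩, h⟩
  have hset : {d : ℤ | Squarefree d ∧ d ≠ 0 ∧ d ≠ 1 ∧
      |D d| ≤ (B : ℤ) ∧ ∃ a b : ℤ, |D d| = a ^ 2 + b ^ 2} =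
      ((((G B).erase 1).image (fun m : ℕ => (m : ℤ)) ∪ ((G (B / 4)).image (fun m : ℕ => -(m : ℤ)) ∪
        ((G (B / 8)).image (fun m : ℕ => 2 * (m : ℤ)) ∪
          (G (B / 8)).image (fun m : ℕ => -(2 * (m : ℤ))))) : Finset ℤ) : Set ℤ) := by
    ext d
    rw [Set.mem_ofPred_eq, discriminant_sum_two_squares_iff (hD d) B]
    simp only [Finset.coe_union, Finset.coe_image, Set.mem_union, Set.mem_image, Finset.mem_coe,
      Finset.mem_erase, hmem]
    grind
  have hpos : ∀ X, ∀ m ∈ G X, m % 4 = 1 := fun X m hm => ((hmem X m).1 hm).1.mod_four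
  have hdisj : ∀ {s t : Finset ℕ} {f g : ℕ → ℤ}, (∀ m ∈ s, m % 4 = 1) → (∀ m ∈ t, m % 4 = 1) →
      (∀ m n : ℕ, m % 4 = 1 → n % 4 = 1 → f m ≠ g n) → Disjoint (s.image f) (t.image g) := by
    intro s t f g hs ht h
    rw [Finset.disjoint_left]
    intro x hx hy
    obtain ⟨m, hm, rfl⟩ := Finset.mem_image.1 hx
    obtain ⟨n, hn, hmn⟩ := Finset.mem_image.1 hy
    exact h m n (hs m hm) (ht n hn) hmn.symm
  have he : ∀ m ∈ (G B).erase 1, m % 4 = 1 := fun m hm => hpos B m (Finset.mem_of_mem_erase hm)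
  have h1 : 1 ∈ G B := (hmem B 1).2 ⟨isSplitSquarefree_one, hB⟩
  have hcard : 1 ≤ (G B).card := Finset.card_pos.2 ⟨1, h1⟩
  have hc1 := splitCount_div B 1
  have hc4 := splitCount_div B 4
  have hc8 := splitCount_div B 8
  rw [Nat.cast_one, div_one, Nat.div_one] at hc1
  push_cast at hc4 hc8
  rw [hset, Set.ncard_coe_finset, Finset.card_union_of_disjoint, Finset.card_union_of_disjoint,
    Finset.card_union_of_disjoint, Finset.card_image_of_injective, Finset.card_image_of_injective,
    Finset.card_image_of_injective, Finset.card_image_of_injective, Finset.card_erase_of_mem h1,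
    hc1, hc4, hc8]
  · push_cast [hcard]
    ring
  · exact fun m n h => by simpa using h
  · exact fun m n h => by simpa using h
  · exact fun m n h => by simpa using h
  · exact fun m n h => by simpa using h
  · exact hdisj (hpos _) (hpos _) fun m n hm hn => by omega
  · rw [Finset.disjoint_union_right]
    exact ⟨hdisj (hpos _) (hpos _) fun m n hm hn => by omega,
      hdisj (hpos _) (hpos _) fun m n hm hn => by omega⟩
  · rw [Finset.disjoint_union_right, Finset.disjoint_union_right]
    exact ⟨hdisj he (hpos _) fun m n hm hn => by omega,
      hdisj he (hpos _) fun m n hm hn => by omega, hdisj he (hpos _) fun m n hm hn => by omega⟩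

lemma tendsto_splitCount_div {C : ℝ}
    (hC : Tendsto (fun x : ℝ => splitCount x * √(Real.log x) / x) atTop (nhds C)) {k : ℝ}
    (hk : 0 < k) :
    Tendsto (fun x : ℝ => splitCount (x / k) * √(Real.log x) / x) atTop (nhds (C / k)) := by
  have h1 : Tendsto (fun x : ℝ => √(1 - Real.log k / Real.log x)) atTop (nhds √(1 - 0)) :=
    (tendsto_const_nhds.sub (Real.tendsto_log_atTop.const_div_atTop _)).sqrt
  rw [sub_zero, Real.sqrt_one] at h1
  have h2 := ((hC.comp (tendsto_id.atTop_div_const hk)).div h1 one_ne_zero).div_const k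
  rw [div_one] at h2
  refine h2.congr' ?_
  filter_upwards [eventually_gt_atTop 1, eventually_gt_atTop k] with x hx hxk
  have hx0 : 0 < x := by linarith
  have hl : 0 < Real.log x := Real.log_pos hx
  have hlk : 0 < Real.log (x / k) := Real.log_pos ((one_lt_div hk).2 hxk)
  have h3 : √(1 - Real.log k / Real.log x) = √(Real.log (x / k)) / √(Real.log x) := by
    rw [← Real.sqrt_div' _ hl.le, Real.log_div hx0.ne' hk.ne']
    congr 1
    field_simp
  have h4 := Real.sqrt_pos.2 hl
  have h5 := Real.sqrt_pos.2 hlk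
  simp only [Function.comp, id, Pi.div_apply]
  rw [h3]
  field_simp

lemma tendsto_sqrt_log_div : Tendsto (fun x : ℝ => √(Real.log x) / x) atTop (nhds 0) := by
  refine squeeze_zero' ?_ ?_ Real.isLittleO_log_id_atTop.tendsto_div_nhds_zero
  · filter_upwards [eventually_ge_atTop 0] with x hx
    positivity
  · filter_upwards [Real.tendsto_log_atTop.eventually_ge_atTop 1, eventually_gt_atTop 0] with x h hx
    simp only [id]
    gcongr
    exact Real.sqrt_le_iff.2 ⟨by linarith, by nlinarith⟩

/-- **Theorem 1.1 for `k = ℚ`, `G = ℤ/2ℤ`.** For a squarefree integer `d ∉ {0, 1}` let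
`D d = d` if `d ≡ 1 (mod 4)` and `D d = 4 * d` otherwise (the discriminant, equal to the
conductor, of `ℚ(√d)`). Let `N B` be the number of squarefree `d ∉ {0, 1}` with `|D d| ≤ B`
and `|D d|` a sum of two squares. Then `N B ∼ c · B · (log B)^{-1/2}` for some constant
`c > 0`. -/
theorem quadratic_fields_with_discriminant_sum_of_two_squares_asymptotic
    (D : ℤ → ℤ) (hD : ∀ d : ℤ, D d = if d % 4 = 1 then d else 4 * d)
    (N : ℕ → ℕ)
    (hN : ∀ B : ℕ, N B = Set.ncard {d : ℤ | Squarefree d ∧ d ≠ 0 ∧ d ≠ 1 ∧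
      |D d| ≤ (B : ℤ) ∧ ∃ a b : ℤ, |D d| = a ^ 2 + b ^ 2}) :
    ∃ c : ℝ, 0 < c ∧
      Tendsto (fun B : ℕ => (N B : ℝ) * Real.sqrt (Real.log B) / B) atTop (nhds c) := by
  obtain ⟨C, hC, hT⟩ := exists_tendsto_splitCount
  refine ⟨C - 0 + C / 4 + 2 * (C / 8), by linarith, ?_⟩
  have h := ((((hT.sub tendsto_sqrt_log_div).add
    (tendsto_splitCount_div hT (show (0 : ℝ) < 4 by norm_num))).add
    ((tendsto_splitCount_div hT (show (0 : ℝ) < 8 by norm_num)).const_mul 2)).comp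
    (tendsto_natCast_atTop_atTop (R := ℝ)))
  refine h.congr' ?_
  filter_upwards [eventually_ge_atTop 1] with B hB
  rw [hN B, ncard_discriminant_sum_two_squares hD hB]
  simp only [Function.comp]
  ring
end
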